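/- arXiv:1610.07546 — 9 statements merged into one kernel-verified Lean document; each statement's English description precedes it below -/
import Mathlib

section
/- Let k be a field, A a k-algebra, and V, W two A-modules. Let ι: V → V ⊕ W and π: V ⊕ W → W be the canonical inclusion and projection. For any submodules U₁ ⊆ V and U₂ ⊆ W, the set of submodules B ⊆ V ⊕ W satisfying ι⁻¹(B) = U₁ and π(B) = U₂ is in bijection with the space of A-module homomorphisms Hom_A(U₂, V/U₁). In particular this set is non-empty. -/
/-!
STATEMENT 0 (Caldero–Chapoton, Lemma 3.8): Let `k` be a field, `A` a `k`-algebra, and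
`V`, `W` two `A`-modules.  Let `ι : V → V ⊕ W` and `π : V ⊕ W → W` be the canonical
inclusion and projection.  For any submodules `U₁ ⊆ V` and `U₂ ⊆ W`, the set of
submodules `B ⊆ V ⊕ W` with `ι⁻¹(B) = U₁` and `π(B) = U₂` is in bijection with
`Hom_A(U₂, V/U₁)`; in particular it is non-empty.
-/

namespace Submodule

variable {A V W : Type*} [Ring A] [AddCommGroup V] [Module A V] [AddCommGroup W] [Module A W]
  {U₁ : Submodule A V} {U₂ : Submodule A W}

/-- The submodule of `V × W` of all pairs `(v, w)` with `w ∈ U₂` and `f w = v + U₁`. -/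
def liftedGraph (f : U₂ →ₗ[A] V ⧸ U₁) : Submodule A (V × W) where
  carrier := {x | ∃ h : x.2 ∈ U₂, f ⟨x.2, h⟩ = U₁.mkQ x.1}
  zero_mem' := ⟨U₂.zero_mem, (map_zero f).trans (map_zero U₁.mkQ).symm⟩
  add_mem' := by
    rintro x y ⟨hx, hfx⟩ ⟨hy, hfy⟩
    refine ⟨U₂.add_mem hx hy, ?_⟩
    rw [Prod.fst_add, map_add, ← hfx, ← hfy, ← map_add]
    rfl
  smul_mem' := by
    rintro a x ⟨hx, hfx⟩
    refine ⟨U₂.smul_mem a hx, ?_⟩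
    rw [Prod.smul_fst, map_smul, ← hfx, ← map_smul]
    rfl

theorem mem_liftedGraph {f : U₂ →ₗ[A] V ⧸ U₁} {x : V × W} :
    x ∈ liftedGraph f ↔ ∃ h : x.2 ∈ U₂, f ⟨x.2, h⟩ = U₁.mkQ x.1 :=
  Iff.rfl

theorem comap_inl_liftedGraph (f : U₂ →ₗ[A] V ⧸ U₁) :
    (liftedGraph f).comap (LinearMap.inl A V W) = U₁ := by
  ext v
  have h0 (h : (0 : W) ∈ U₂) : f ⟨0, h⟩ = 0 := map_zero f
  simp [mem_liftedGraph, h0, eq_comm (a := (0 : V ⧸ U₁))]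

theorem map_snd_liftedGraph (f : U₂ →ₗ[A] V ⧸ U₁) :
    (liftedGraph f).map (LinearMap.snd A V W) = U₂ := by
  ext w
  constructor
  · rintro ⟨x, ⟨h, -⟩, rfl⟩
    exact h
  · intro h
    obtain ⟨v, hv⟩ := U₁.mkQ_surjective (f ⟨w, h⟩)
    exact ⟨(v, w), ⟨h, hv.symm⟩, rfl⟩

theorem liftedGraph_injective :
    Function.Injective (liftedGraph : (U₂ →ₗ[A] V ⧸ U₁) → Submodule A (V × W)) := by
  intro f g hfg
  ext u
  obtain ⟨v, hv⟩ := U₁.mkQ_surjective (f u)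
  have hmem : (v, (u : W)) ∈ liftedGraph f := ⟨u.2, hv.symm⟩
  rw [hfg] at hmem
  obtain ⟨_, hg⟩ := hmem
  exact hv.symm.trans hg.symm

theorem exists_liftedGraph_eq {B : Submodule A (V × W)}
    (h₁ : B.comap (LinearMap.inl A V W) = U₁) (h₂ : B.map (LinearMap.snd A V W) = U₂) :
    ∃ f : U₂ →ₗ[A] V ⧸ U₁, liftedGraph f = B := by
  have hex (u : U₂) : ∃ v, (v, (u : W)) ∈ B := by
    obtain ⟨x, hx, hxu⟩ := h₂.ge u.2
    exact ⟨x.1, hxu ▸ hx⟩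
  have hmk {v v' : V} {w : W} (h : (v, w) ∈ B) : U₁.mkQ v' = U₁.mkQ v ↔ (v', w) ∈ B := by
    rw [mkQ_apply, mkQ_apply, Submodule.Quotient.eq, ← h₁, mem_comap, LinearMap.inl_apply,
      ← B.add_mem_iff_left h]
    simp
  choose s hs using hex
  let f : U₂ →ₗ[A] V ⧸ U₁ :=
    { toFun := fun u => U₁.mkQ (s u)
      map_add' := fun u u' => by
        rw [← map_add]
        exact ((hmk (hs (u + u'))).2 (B.add_mem (hs u) (hs u'))).symm
      map_smul' := fun a u => by
        rw [RingHom.id_apply, ← map_smul]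
        exact ((hmk (hs (a • u))).2 (B.smul_mem a (hs u))).symm }
  refine ⟨f, ?_⟩
  ext ⟨v, w⟩
  constructor
  · rintro ⟨h, hf⟩
    exact (hmk (hs ⟨w, h⟩)).1 hf.symm
  · intro h
    have hw : w ∈ U₂ := h₂ ▸ ⟨(v, w), h, rfl⟩
    exact ⟨hw, ((hmk (hs ⟨w, hw⟩)).2 h).symm⟩

/-- Submodules of `V × W` with trace `U₁` on `V` and projection `U₂` to `W` correspond to
linear maps `U₂ → V ⧸ U₁`. -/
noncomputable def liftedGraphEquiv (U₁ : Submodule A V) (U₂ : Submodule A W) :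
    (U₂ →ₗ[A] V ⧸ U₁) ≃
      {B : Submodule A (V × W) //
        B.comap (LinearMap.inl A V W) = U₁ ∧ B.map (LinearMap.snd A V W) = U₂} :=
  Equiv.ofBijective
    (fun f => ⟨liftedGraph f, comap_inl_liftedGraph f, map_snd_liftedGraph f⟩)
    ⟨fun _ _ h => liftedGraph_injective (congrArg Subtype.val h), fun B =>
      (exists_liftedGraph_eq B.2.1 B.2.2).imp fun _ h => Subtype.ext h⟩

end Submodule

theorem cc_direct_sum_fiber
    (k : Type*) [Field k] (A : Type*) [Ring A] [Algebra k A]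
    (V W : Type*) [AddCommGroup V] [Module A V] [AddCommGroup W] [Module A W]
    (U₁ : Submodule A V) (U₂ : Submodule A W) :
    Nonempty
      ({B : Submodule A (V × W) //
          B.comap (LinearMap.inl A V W) = U₁ ∧ B.map (LinearMap.snd A V W) = U₂}
        ≃ (U₂ →ₗ[A] V ⧸ U₁)) ∧
    Nonempty
      {B : Submodule A (V × W) //
          B.comap (LinearMap.inl A V W) = U₁ ∧ B.map (LinearMap.snd A V W) = U₂} :=
  ⟨⟨(Submodule.liftedGraphEquiv U₁ U₂).symm⟩, ⟨Submodule.liftedGraphEquiv U₁ U₂ 0⟩⟩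
end

section
/- Let k be a field, A a k-algebra, and 0 → X →ⁱ E →ᵖ V → 0 a short exact sequence of A-modules. For any submodules A' ⊆ X and B ⊆ V, the set of submodules W ⊆ E satisfying i⁻¹(W) = A' and p(W) = B is either empty or in bijection with the space of A-module homomorphisms Hom_A(B, X/A'). -/
/-!
STATEMENT 1: Let `k` be a field, `A` a `k`-algebra, and `0 → X →ⁱ E →ᵖ V → 0` a short
exact sequence of `A`-modules.  For any submodules `A' ⊆ X` and `B ⊆ V`, the set of
submodules `W ⊆ E` with `i⁻¹(W) = A'` and `p(W) = B` is either empty or in bijection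
with `Hom_A(B, X/A')`.
-/

section SubmoduleTwist

variable {A X E V : Type*} [Ring A] [AddCommGroup X] [Module A X] [AddCommGroup E] [Module A E]
  [AddCommGroup V] [Module A V] {i : X →ₗ[A] E} {p : E →ₗ[A] V}
  {A' : Submodule A X} {B : Submodule A V} {W₀ : Submodule A E}

/-- The submodule of all `w + i x` with `w ∈ W₀` and `x` in the coset `f (p w)`. -/
def Submodule.twist (i : X →ₗ[A] E) (p : E →ₗ[A] V) (h : ∀ w ∈ W₀, p w ∈ B)
    (f : B →ₗ[A] X ⧸ A') : Submodule A E :=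
  (LinearMap.eqLocus (A'.mkQ ∘ₗ LinearMap.snd A W₀ X)
    (f ∘ₗ p.restrict h ∘ₗ LinearMap.fst A W₀ X)).map (W₀.subtype.coprod i)

theorem Submodule.mem_twist (h : ∀ w ∈ W₀, p w ∈ B) (f : B →ₗ[A] X ⧸ A') (e : E) :
    e ∈ Submodule.twist i p h f ↔
      ∃ w, ∃ hw : w ∈ W₀, ∃ x, A'.mkQ x = f ⟨p w, h w hw⟩ ∧ w + i x = e := by
  constructor
  · rintro ⟨⟨⟨w, hw⟩, x⟩, hx, rfl⟩
    exact ⟨w, hw, x, hx, rfl⟩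
  · rintro ⟨w, hw, x, hx, rfl⟩
    exact ⟨⟨⟨w, hw⟩, x⟩, hx, rfl⟩

theorem exists_mem_sub_eq_of_map_eq (hexact : LinearMap.range i = LinearMap.ker p)
    (hW₀ : W₀.comap i = A') {w w' : E} (hw : w ∈ W₀) (hw' : w' ∈ W₀) (h : p w = p w') :
    ∃ y ∈ A', i y = w - w' := by
  have hker : w - w' ∈ LinearMap.range i := by
    rw [hexact, LinearMap.mem_ker, map_sub, h, sub_self]
  obtain ⟨y, hy⟩ := hker
  refine ⟨y, ?_, hy⟩
  rw [← hW₀, Submodule.mem_comap, hy]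
  exact W₀.sub_mem hw hw'

theorem Submodule.comap_twist (hi : Function.Injective i)
    (hexact : LinearMap.range i = LinearMap.ker p) (h : ∀ w ∈ W₀, p w ∈ B)
    (hW₀ : W₀.comap i = A') (f : B →ₗ[A] X ⧸ A') :
    (Submodule.twist i p h f).comap i = A' := by
  have hpi (x : X) : p (i x) = 0 := by
    rw [← LinearMap.mem_ker, ← hexact]
    exact LinearMap.mem_range_self i x
  ext x
  rw [Submodule.mem_comap, Submodule.mem_twist]
  constructor
  · rintro ⟨w, hw, z, hz, hwz⟩
    have hpw : p w = 0 := by simpa [hpi] using congrArg p hwz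
    obtain ⟨y, hy, hyw⟩ := exists_mem_sub_eq_of_map_eq hexact hW₀ hw W₀.zero_mem
      (hpw.trans (map_zero p).symm)
    have hzA : z ∈ A' := by
      have hb : (⟨p w, h w hw⟩ : B) = 0 := Subtype.ext hpw
      rw [hb, map_zero] at hz
      simpa using hz
    have hx : y + z = x := hi (by rw [map_add, hyw, sub_zero, hwz])
    exact hx ▸ A'.add_mem hy hzA
  · intro hx
    have hb : (⟨p 0, h 0 W₀.zero_mem⟩ : B) = 0 := Subtype.ext (map_zero p)
    refine ⟨0, W₀.zero_mem, x, ?_, zero_add _⟩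
    rw [hb, map_zero]
    simpa using hx

theorem Submodule.map_twist (hexact : LinearMap.range i = LinearMap.ker p)
    (h : ∀ w ∈ W₀, p w ∈ B) (hB : W₀.map p = B) (f : B →ₗ[A] X ⧸ A') :
    (Submodule.twist i p h f).map p = B := by
  have hpi (x : X) : p (i x) = 0 := by
    rw [← LinearMap.mem_ker, ← hexact]
    exact LinearMap.mem_range_self i x
  apply le_antisymm
  · rintro _ ⟨e, he, rfl⟩
    obtain ⟨w, hw, x, -, rfl⟩ := (Submodule.mem_twist h f e).1 he
    simpa [hpi] using h w hw
  · intro b hb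
    obtain ⟨w, hw, rfl⟩ : b ∈ W₀.map p := hB ▸ hb
    obtain ⟨x, hx⟩ := A'.mkQ_surjective (f ⟨p w, h w hw⟩)
    exact ⟨w + i x, (Submodule.mem_twist h f _).2 ⟨w, hw, x, hx, rfl⟩, by simp [hpi]⟩

theorem Submodule.twist_injective (hi : Function.Injective i)
    (hexact : LinearMap.range i = LinearMap.ker p) (h : ∀ w ∈ W₀, p w ∈ B)
    (hW₀ : W₀.comap i = A') (hB : W₀.map p = B) :
    Function.Injective (Submodule.twist (A' := A') i p h) := by
  have hpi (x : X) : p (i x) = 0 := by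
    rw [← LinearMap.mem_ker, ← hexact]
    exact LinearMap.mem_range_self i x
  intro f g hfg
  ext ⟨b, hb⟩
  obtain ⟨w, hw, rfl⟩ : b ∈ W₀.map p := hB ▸ hb
  obtain ⟨x, hx⟩ := A'.mkQ_surjective (f ⟨p w, hb⟩)
  have hmem : w + i x ∈ Submodule.twist i p h g :=
    hfg ▸ (Submodule.mem_twist h f _).2 ⟨w, hw, x, hx, rfl⟩
  obtain ⟨w', hw', x', hx', he⟩ := (Submodule.mem_twist h g _).1 hmem
  have hpw : p w' = p w := by simpa [hpi] using congrArg p he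
  obtain ⟨y, hy, hyw⟩ := exists_mem_sub_eq_of_map_eq hexact hW₀ hw' hw hpw
  have hxy : x - x' = y := hi (by
    rw [map_sub, hyw, sub_eq_sub_iff_add_eq_add, add_comm, he])
  have hb' : (⟨p w', h w' hw'⟩ : B) = ⟨p w, hb⟩ := Subtype.ext hpw
  rw [← hx, ← hb', ← hx']
  exact (Submodule.Quotient.eq A').2 (hxy ▸ hy)

theorem Submodule.exists_twist_eq (hexact : LinearMap.range i = LinearMap.ker p)
    (h : ∀ w ∈ W₀, p w ∈ B) (hW₀ : W₀.comap i = A') (hB : W₀.map p = B)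
    {W : Submodule A E} (hW : W.comap i = A') (hWB : W.map p = B) :
    ∃ f : B →ₗ[A] X ⧸ A', Submodule.twist i p h f = W := by
  have hiW {y : X} : i y ∈ W ↔ y ∈ A' := by rw [← hW, Submodule.mem_comap]
  have hex (b : B) : ∃ w ∈ W₀, ∃ x, p w = b ∧ w + i x ∈ W := by
    obtain ⟨w, hw, hwb⟩ : (b : V) ∈ W₀.map p := hB ▸ b.2
    obtain ⟨e, he, heb⟩ : (b : V) ∈ W.map p := hWB ▸ b.2
    obtain ⟨x, hx⟩ : e - w ∈ LinearMap.range i := by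
      rw [hexact, LinearMap.mem_ker, map_sub, hwb, heb, sub_self]
    exact ⟨w, hw, x, hwb, by rwa [hx, add_sub_cancel]⟩
  have huniq {w w' : E} {x x' : X} (hw : w ∈ W₀) (hw' : w' ∈ W₀) (hp : p w = p w')
      (hx' : w' + i x' ∈ W) : w + i x ∈ W ↔ A'.mkQ x = A'.mkQ x' := by
    obtain ⟨y, hy, hyw⟩ := exists_mem_sub_eq_of_map_eq hexact hW₀ hw hw' hp
    have he : w + i x = i (x - x') + (i y + (w' + i x')) := by
      rw [hyw, map_sub]; abel
    rw [he, W.add_mem_iff_left (W.add_mem (hiW.2 hy) hx'), hiW]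
    exact (Submodule.Quotient.eq A').symm
  choose w hw x hpw hx using hex
  let f : B →ₗ[A] X ⧸ A' :=
    { toFun := fun b => A'.mkQ (x b)
      map_add' := fun b c => by
        rw [← map_add]
        refine ((huniq (W₀.add_mem (hw b) (hw c)) (hw (b + c)) ?_ (hx (b + c))).1 ?_).symm
        · simp [hpw]
        · rw [map_add, add_add_add_comm]
          exact W.add_mem (hx b) (hx c)
      map_smul' := fun a b => by
        rw [RingHom.id_apply, ← map_smul]
        refine ((huniq (W₀.smul_mem a (hw b)) (hw (a • b)) ?_ (hx (a • b))).1 ?_).symm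
        · simp [hpw]
        · rw [map_smul, ← smul_add]
          exact W.smul_mem a (hx b) }
  refine ⟨f, ?_⟩
  ext e
  rw [Submodule.mem_twist]
  constructor
  · rintro ⟨v, hv, z, hz, rfl⟩
    exact (huniq hv (hw _) (hpw ⟨p v, h v hv⟩).symm (hx _)).2 hz
  · intro he
    have hb : p e ∈ B := hWB ▸ Submodule.mem_map_of_mem he
    obtain ⟨v, hv, hve⟩ : p e ∈ W₀.map p := hB ▸ hb
    obtain ⟨z, hz⟩ : e - v ∈ LinearMap.range i := by
      rw [hexact, LinearMap.mem_ker, map_sub, hve, sub_self]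
    have hvz : v + i z = e := by rw [hz, add_sub_cancel]
    exact ⟨v, hv, z, (huniq hv (hw _) (hpw ⟨p v, h v hv⟩).symm (hx _)).1 (hvz ▸ he), hvz⟩

end SubmoduleTwist

theorem ses_fiber_empty_or_hom
    (k : Type*) [Field k] (A : Type*) [Ring A] [Algebra k A]
    (X E V : Type*) [AddCommGroup X] [Module A X] [AddCommGroup E] [Module A E]
    [AddCommGroup V] [Module A V]
    (i : X →ₗ[A] E) (p : E →ₗ[A] V)
    (hi : Function.Injective i) (hp : Function.Surjective p)
    (hexact : LinearMap.range i = LinearMap.ker p)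
    (A' : Submodule A X) (B : Submodule A V) :
    IsEmpty {W : Submodule A E // W.comap i = A' ∧ W.map p = B} ∨
    Nonempty
      ({W : Submodule A E // W.comap i = A' ∧ W.map p = B} ≃ (B →ₗ[A] X ⧸ A')) := by
  rcases isEmpty_or_nonempty {W : Submodule A E // W.comap i = A' ∧ W.map p = B} with
    hempty | ⟨⟨W₀, hW₀, hB⟩⟩
  · exact Or.inl hempty
  · have h (w : E) (hw : w ∈ W₀) : p w ∈ B := hB ▸ Submodule.mem_map_of_mem hw
    refine Or.inr ⟨(Equiv.ofBijective (fun f => ⟨Submodule.twist i p h f,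
      Submodule.comap_twist hi hexact h hW₀ f, Submodule.map_twist hexact h hB f⟩)
      ⟨fun f g hfg => ?_, ?_⟩).symm⟩
    · exact Submodule.twist_injective hi hexact h hW₀ hB (congrArg Subtype.val hfg)
    · rintro ⟨W, hW, hWB⟩
      obtain ⟨f, hf⟩ := Submodule.exists_twist_eq hexact h hW₀ hB hW hWB
      exact ⟨f, Subtype.ext hf⟩
end

section
/- Let k be a field, A a finite-dimensional k-algebra, and 0 → X →ⁱ E →ᵖ V → 0 an almost split (Auslander–Reiten) sequence of finite-dimensional A-modules. For submodules A' ⊆ X and B ⊆ V, there exists a submodule W ⊆ E with i⁻¹(W) = A' and p(W) = B if and only if (A', B) ≠ (0, V). -/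
/-!
STATEMENT 2: Let `k` be a field, `A` a finite-dimensional `k`-algebra, and
`0 → X →ⁱ E →ᵖ V → 0` an almost split (Auslander–Reiten) sequence of finite-dimensional
`A`-modules.  For submodules `A' ⊆ X` and `B ⊆ V`, there exists a submodule `W ⊆ E` with
`i⁻¹(W) = A'` and `p(W) = B` if and only if `(A', B) ≠ (0, V)`.
-/

universe u v

/-- A module is indecomposable if it is non-zero and admits no non-trivial direct sum
decomposition (no pair of complementary non-zero submodules). -/
def IsIndecomposableModule (A : Type u) [Ring A] (M : Type v) [AddCommGroup M]
    [Module A M] : Prop :=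
  Nontrivial M ∧ ∀ S T : Submodule A M, IsCompl S T → S = ⊥ ∨ T = ⊥

theorem LinearMap.exists_section_of_comap_eq_bot_of_map_eq_top {A X E V : Type*} [Ring A]
    [AddCommGroup X] [Module A X] [AddCommGroup E] [Module A E] [AddCommGroup V] [Module A V]
    {i : X →ₗ[A] E} {p : E →ₗ[A] V} (hexact : LinearMap.range i = LinearMap.ker p)
    {W : Submodule A E} (hW : W.comap i = ⊥) (hWp : W.map p = ⊤) :
    ∃ s : V →ₗ[A] E, p ∘ₗ s = LinearMap.id := by
  have hinj : Function.Injective (p.domRestrict W) := by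
    rw [← LinearMap.ker_eq_bot, LinearMap.ker_eq_bot']
    rintro ⟨w, hw⟩ hpw
    have hmem : w ∈ LinearMap.range i := hexact ▸ hpw
    obtain ⟨x, rfl⟩ := hmem
    have hx : x ∈ W.comap i := hw
    rw [hW, Submodule.mem_bot] at hx
    simp [hx]
  have hsurj : Function.Surjective (p.domRestrict W) := by
    intro v
    obtain ⟨w, hw, rfl⟩ : v ∈ W.map p := hWp ▸ Submodule.mem_top
    exact ⟨⟨w, hw⟩, rfl⟩
  refine ⟨W.subtype ∘ₗ (LinearEquiv.ofBijective _ ⟨hinj, hsurj⟩).symm.toLinearMap, ?_⟩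
  ext v
  exact (LinearEquiv.ofBijective _ ⟨hinj, hsurj⟩).apply_symm_apply v

/-- If the inclusion of `B` into `V` lifts to `E`, then every pair `(A', B)` is realised by a
submodule of `E`. -/
theorem LinearMap.exists_comap_eq_map_eq_of_lift {A X E V : Type*} [Ring A]
    [AddCommGroup X] [Module A X] [AddCommGroup E] [Module A E] [AddCommGroup V] [Module A V]
    {i : X →ₗ[A] E} {p : E →ₗ[A] V} (hi : Function.Injective i)
    (hexact : LinearMap.range i = LinearMap.ker p) (A' : Submodule A X) {B : Submodule A V}
    {h : B →ₗ[A] E} (hh : p ∘ₗ h = B.subtype) :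
    ∃ W : Submodule A E, W.comap i = A' ∧ W.map p = B := by
  have hpi (x : X) : p (i x) = 0 := LinearMap.mem_ker.mp (hexact ▸ ⟨x, rfl⟩)
  have hph (b : B) : p (h b) = b := LinearMap.congr_fun hh b
  refine ⟨A'.map i ⊔ LinearMap.range h, le_antisymm ?_ ?_, le_antisymm ?_ ?_⟩
  · intro x hx
    obtain ⟨_, ⟨a, ha, rfl⟩, _, ⟨b, rfl⟩, hab⟩ := Submodule.mem_sup.mp (Submodule.mem_comap.mp hx)
    have hb : (b : V) = 0 := by
      simpa [hpi, hph] using congrArg p hab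
    have hb' : b = 0 := Subtype.ext hb
    rw [hb', map_zero, add_zero] at hab
    exact hi hab ▸ ha
  · exact fun x hx => Submodule.mem_sup_left ⟨x, hx, rfl⟩
  · rintro _ ⟨w, hw, rfl⟩
    obtain ⟨_, ⟨a, -, rfl⟩, _, ⟨b, rfl⟩, rfl⟩ := Submodule.mem_sup.mp hw
    simp [hpi, hph]
  · exact fun b hb => ⟨h ⟨b, hb⟩, Submodule.mem_sup_right ⟨_, rfl⟩, hph _⟩

/-- Fitting's lemma: a non-injective endomorphism of an indecomposable module of finite length
is nilpotent. -/
theorem IsIndecomposableModule.isNilpotent_of_not_injective {A : Type u} {M : Type v} [Ring A]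
    [AddCommGroup M] [Module A M] [IsNoetherian A M] [IsArtinian A M]
    (hM : IsIndecomposableModule A M) {f : Module.End A M} (hf : ¬ Function.Injective f) :
    IsNilpotent f := by
  obtain ⟨n, hn, hc⟩ := (f.eventually_isCompl_ker_pow_range_pow.and
    (Filter.eventually_ge_atTop 1)).exists.imp fun n h => And.symm h
  rcases hM.2 _ _ hc with hker | hrange
  · refine absurd ?_ hf
    have hinj := LinearMap.ker_eq_bot.mp hker
    rw [Module.End.coe_pow] at hinj
    obtain ⟨m, rfl⟩ : ∃ m, n = m + 1 := ⟨n - 1, by omega⟩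
    rw [Function.iterate_succ] at hinj
    exact hinj.of_comp
  · exact ⟨n, LinearMap.range_eq_bot.mp hrange⟩

/-- If the kernel term of a non-split short exact sequence is indecomposable of finite length, then
an endomorphism of the middle term over `V` is injective on the kernel term. -/
theorem IsIndecomposableModule.injective_comp_of_nonsplit {A : Type u} {X : Type v} {E V : Type*}
    [Ring A] [AddCommGroup X] [Module A X] [AddCommGroup E] [Module A E]
    [AddCommGroup V] [Module A V] [IsNoetherian A X] [IsArtinian A X]
    (hX : IsIndecomposableModule A X) {i : X →ₗ[A] E} {p : E →ₗ[A] V}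
    (hi : Function.Injective i) (hp : Function.Surjective p)
    (hexact : LinearMap.range i = LinearMap.ker p)
    (hnonsplit : ¬ ∃ s : V →ₗ[A] E, p ∘ₗ s = LinearMap.id)
    {φ : Module.End A E} (hφ : p ∘ₗ φ = p) : Function.Injective (φ ∘ₗ i) := by
  by_contra hninj
  have hpφ (e : E) : p (φ e) = p e := LinearMap.congr_fun hφ e
  have hmem (x : X) : φ (i x) ∈ LinearMap.range i := by
    rw [hexact, LinearMap.mem_ker, hpφ, ← LinearMap.mem_ker, ← hexact]
    exact ⟨x, rfl⟩
  let ψ : Module.End A X :=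
    (LinearEquiv.ofInjective i hi).symm.toLinearMap ∘ₗ (φ ∘ₗ i).codRestrict _ hmem
  have hψ (x : X) : i (ψ x) = φ (i x) :=
    congrArg Subtype.val ((LinearEquiv.ofInjective i hi).apply_symm_apply ⟨φ (i x), hmem x⟩)
  have hψinj : ¬ Function.Injective ψ := fun h => hninj <| by
    have : (⇑(φ ∘ₗ i)) = i ∘ ψ := funext fun x => (hψ x).symm
    rw [this]
    exact hi.comp h
  obtain ⟨n, hn⟩ := hX.isNilpotent_of_not_injective hψinj
  have hψn (m : ℕ) (x : X) : (φ ^ m) (i x) = i ((ψ ^ m) x) := by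
    induction m with
    | zero => rfl
    | succ m ih => rw [pow_succ', pow_succ', Module.End.mul_apply, ih, Module.End.mul_apply, hψ]
  have hpφn (m : ℕ) (e : E) : p ((φ ^ m) e) = p e := by
    induction m with
    | zero => rfl
    | succ m ih => rw [pow_succ', Module.End.mul_apply, hpφ, ih]
  have hker : LinearMap.ker p ≤ LinearMap.ker (φ ^ n) := by
    rw [← hexact]
    rintro _ ⟨x, rfl⟩
    rw [LinearMap.mem_ker, hψn, hn, LinearMap.zero_apply, map_zero]
  refine hnonsplit ⟨(LinearMap.ker p).liftQ (φ ^ n) hker ∘ₗ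
    (p.quotKerEquivOfSurjective hp).symm.toLinearMap, ?_⟩
  ext v
  obtain ⟨e, rfl⟩ := hp v
  have he : (p.quotKerEquivOfSurjective hp).symm (p e) = (LinearMap.ker p).mkQ e := by
    rw [LinearEquiv.symm_apply_eq]
    rfl
  simp only [LinearMap.comp_apply, LinearEquiv.coe_coe, he, LinearMap.id_apply]
  exact hpφn n e

theorem almost_split_lifting_dichotomy
    (k : Type u) [Field k] (A : Type u) [Ring A] [Algebra k A] [FiniteDimensional k A]
    (X E V : Type v)
    [AddCommGroup X] [Module k X] [Module A X] [IsScalarTower k A X]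
    [AddCommGroup E] [Module k E] [Module A E] [IsScalarTower k A E]
    [AddCommGroup V] [Module k V] [Module A V] [IsScalarTower k A V]
    [FiniteDimensional k X] [FiniteDimensional k E] [FiniteDimensional k V]
    (i : X →ₗ[A] E) (p : E →ₗ[A] V)
    -- short exact sequence
    (hi : Function.Injective i) (hp : Function.Surjective p)
    (hexact : LinearMap.range i = LinearMap.ker p)
    -- the sequence is non-split
    (hnonsplit : ¬ ∃ s : V →ₗ[A] E, p ∘ₗ s = LinearMap.id)
    -- the end terms are indecomposable
    (hX : IsIndecomposableModule A X) (hV : IsIndecomposableModule A V)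
    -- every morphism to `V` that is not a split epimorphism factors through `p`
    (hAR : ∀ (Z : Type v) [AddCommGroup Z] [Module k Z] [Module A Z]
      [IsScalarTower k A Z] [FiniteDimensional k Z] (g : Z →ₗ[A] V),
      (¬ ∃ s : V →ₗ[A] Z, g ∘ₗ s = LinearMap.id) → ∃ h : Z →ₗ[A] E, p ∘ₗ h = g)
    (A' : Submodule A X) (B : Submodule A V) :
    (∃ W : Submodule A E, W.comap i = A' ∧ W.map p = B) ↔ ¬ (A' = ⊥ ∧ B = ⊤) := by
  have hpi (x : X) : p (i x) = 0 := LinearMap.mem_ker.mp (hexact ▸ ⟨x, rfl⟩)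
  constructor
  · rintro ⟨W, hW, hWp⟩ ⟨rfl, rfl⟩
    exact hnonsplit (LinearMap.exists_section_of_comap_eq_bot_of_map_eq_top hexact hW hWp)
  intro hAB
  by_cases hB : B = ⊤
  · have hA : A' ≠ ⊥ := fun h => hAB ⟨h, hB⟩
    have : IsNoetherian A X := isNoetherian_of_tower k inferInstance
    have : IsArtinian A X := isArtinian_of_tower k inferInstance
    let S : Submodule A E := A'.map i
    have hS : S ≤ LinearMap.ker p := by
      rintro _ ⟨x, -, rfl⟩
      exact hpi x
    have : FiniteDimensional k (E ⧸ S) :=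
      Module.Finite.of_surjective (S.mkQ.restrictScalars k) S.mkQ_surjective
    obtain ⟨s, hs⟩ : ∃ s : V →ₗ[A] E ⧸ S, S.liftQ p hS ∘ₗ s = LinearMap.id := by
      by_contra hns
      obtain ⟨h, hh⟩ := hAR (E ⧸ S) (S.liftQ p hS) hns
      have hφ : p ∘ₗ (h ∘ₗ S.mkQ) = p := by
        rw [← LinearMap.comp_assoc, hh, Submodule.liftQ_mkQ]
      have hinj := hX.injective_comp_of_nonsplit hi hp hexact hnonsplit hφ
      refine hA ((Submodule.eq_bot_iff _).mpr fun x hx => hinj ?_)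
      have hx0 : S.mkQ (i x) = 0 := (Submodule.Quotient.mk_eq_zero S).mpr ⟨x, hx, rfl⟩
      simp only [LinearMap.comp_apply, hx0, map_zero]
    have hs' (v : V) : S.liftQ p hS (s v) = v := LinearMap.congr_fun hs v
    refine ⟨(LinearMap.range s).comap S.mkQ, le_antisymm ?_ ?_, ?_⟩
    · rintro x ⟨v, hv⟩
      have hv0 : v = 0 := by
        rw [← hs' v, hv]
        exact hpi x
      rw [hv0, map_zero] at hv
      obtain ⟨a, ha, hax⟩ := (Submodule.Quotient.mk_eq_zero S).mp hv.symm
      exact hi hax ▸ ha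
    · intro x hx
      exact ⟨0, by rw [map_zero]; exact ((Submodule.Quotient.mk_eq_zero S).mpr ⟨x, hx, rfl⟩).symm⟩
    · rw [hB, eq_top_iff]
      intro v _
      obtain ⟨e, he⟩ := S.mkQ_surjective (s v)
      refine ⟨e, ⟨v, he.symm⟩, ?_⟩
      rw [← hs' v, ← he]
      rfl
  · have : FiniteDimensional k B :=
      Module.Finite.of_injective (B.subtype.restrictScalars k) Subtype.val_injective
    obtain ⟨h, hh⟩ := hAR B B.subtype fun ⟨s, hs⟩ => hB <| eq_top_iff.mpr fun v _ => by
      have hv : ((s v : B) : V) = v := LinearMap.congr_fun hs v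
      exact hv ▸ (s v).2
    exact LinearMap.exists_comap_eq_map_eq_of_lift hi hexact A' hh
end

section
/- Let C be as in the 2-Calabi–Yau setup and let T be a cluster-tilting object of C. Then for any object X of C there exists a distinguished triangle T₁ → T₀ → X → ΣT₁ in which both T₀ and T₁ belong to add T. -/
/-!
STATEMENT 4 (Keller–Reiten): In the 2-Calabi–Yau setup, if `T` is a cluster-tilting
object, then every object `X` admits a distinguished triangle `T₁ → T₀ → X → ΣT₁`
with `T₀` and `T₁` in `add T`.

Krull–Schmidt is encoded as idempotent completeness, which, together with
Hom-finiteness over the field `k`, is equivalent to the Krull–Schmidt property.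
-/
open CategoryTheory Limits Pretriangulated

universe v u

section Setup

variable {C : Type u} [Category.{v} C] [Preadditive C] [HasZeroObject C]
  [HasShift C ℤ] [∀ n : ℤ, (shiftFunctor C n).Additive] [Pretriangulated C]
  [HasFiniteBiproducts C]

/-- `X` belongs to `add T`: it is a direct summand of a finite direct sum of copies
of `T`. -/
def InAdd (T X : C) : Prop :=
  ∃ (n : ℕ) (Y : C), Nonempty ((X ⊞ Y) ≅ ⨁ (fun _ : Fin n => T))

/-- `T` is rigid if `Hom(T, ΣT) = 0`. -/
def IsRigid (T : C) : Prop := ∀ f : T ⟶ T⟦(1 : ℤ)⟧, f = 0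

/-- `T` is cluster-tilting if it is rigid and every object `X` with `Hom(T, ΣX) = 0`
lies in `add T`. -/
def IsClusterTilting (T : C) : Prop :=
  IsRigid T ∧ ∀ X : C, (∀ f : T ⟶ X⟦(1 : ℤ)⟧, f = 0) → InAdd T X

end Setup

/-- A 2-Calabi–Yau structure: a bifunctorial isomorphism
`Hom(X, ΣY) ≅ (Hom(Y, ΣX))^*`. -/
structure TwoCYStructure (k : Type*) [Field k] (C : Type u) [Category.{v} C]
    [Preadditive C] [Linear k C] [HasShift C ℤ] where
  pair : ∀ X Y : C, (X ⟶ Y⟦(1 : ℤ)⟧) →ₗ[k] Module.Dual k (Y ⟶ X⟦(1 : ℤ)⟧)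
  bijective : ∀ X Y : C, Function.Bijective (pair X Y)
  nat_left : ∀ {X X' Y : C} (u : X' ⟶ X) (α : X ⟶ Y⟦(1 : ℤ)⟧) (β : Y ⟶ X'⟦(1 : ℤ)⟧),
    pair X' Y (u ≫ α) β = pair X Y α (β ≫ u⟦(1 : ℤ)⟧')
  nat_right : ∀ {X Y Y' : C} (v : Y ⟶ Y') (α : X ⟶ Y⟦(1 : ℤ)⟧) (β : Y' ⟶ X⟦(1 : ℤ)⟧),
    pair X Y' (α ≫ v⟦(1 : ℤ)⟧') β = pair X Y α (v ≫ β)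

section Helpers

variable {C : Type u} [Category.{v} C] [Preadditive C] [HasFiniteBiproducts C]

open scoped ZeroObject in
lemma inAdd_biproduct [HasZeroObject C] [HasShift C ℤ]
    [∀ n : ℤ, (shiftFunctor C n).Additive] [Pretriangulated C] (T : C) (n : ℕ) :
    InAdd T (⨁ (fun _ : Fin n => T)) :=
  ⟨n, 0, ⟨(isoBiprodZero (isZero_zero C)).symm⟩⟩

/-- A rigid object has no nonzero morphism to the shift of a finite direct sum of its copies. -/
lemma IsRigid.eq_zero_of_biproduct [HasShift C ℤ] [∀ n : ℤ, (shiftFunctor C n).Additive]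
    {T : C} (hT : IsRigid T) {n : ℕ} (f : T ⟶ (⨁ (fun _ : Fin n => T))⟦(1 : ℤ)⟧) : f = 0 := by
  have h : f ≫ (𝟙 (⨁ (fun _ : Fin n => T)))⟦(1 : ℤ)⟧' = 0 := by
    rw [← biproduct.total, Functor.map_sum, Preadditive.comp_sum]
    refine Finset.sum_eq_zero fun i _ => ?_
    rw [Functor.map_comp, ← Category.assoc, hT (f ≫ _), zero_comp]
  simpa using h

/-- If `Hom(T, X)` is finitely generated, some morphism `Tⁿ ⟶ X` is a right `add T`-approximation:
every morphism `T ⟶ X` factors through it. -/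
lemma exists_biproduct_factorization (k : Type*) [Semiring k] [Linear k C] (T X : C)
    [Module.Finite k (T ⟶ X)] :
    ∃ (n : ℕ) (g : (⨁ (fun _ : Fin n => T)) ⟶ X),
      ∀ f : T ⟶ X, ∃ l : T ⟶ ⨁ (fun _ : Fin n => T), l ≫ g = f := by
  obtain ⟨n, s, hs⟩ := Module.Finite.exists_fin (R := k) (M := T ⟶ X)
  refine ⟨n, biproduct.desc s, fun f => ?_⟩
  obtain ⟨c, hc⟩ := (Submodule.mem_span_range_iff_exists_fun k).1
    (hs ▸ Submodule.mem_top : f ∈ Submodule.span k (Set.range s))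
  exact ⟨biproduct.lift fun i => c i • 𝟙 T, by simp [biproduct.lift_desc, hc]⟩

end Helpers

theorem exists_addT_presentation_triangle
    (k : Type*) [Field k]
    (C : Type u) [Category.{v} C] [Preadditive C] [Linear k C] [HasZeroObject C]
    [HasShift C ℤ] [∀ n : ℤ, (shiftFunctor C n).Additive] [Pretriangulated C]
    [HasFiniteBiproducts C] [IsIdempotentComplete C]
    (hfd : ∀ X Y : C, FiniteDimensional k (X ⟶ Y))
    (cy : TwoCYStructure k C)
    (T : C) (hT : IsClusterTilting T)
    (X : C) :
    ∃ (T₁ T₀ : C) (f : T₁ ⟶ T₀) (g : T₀ ⟶ X) (h : X ⟶ T₁⟦(1 : ℤ)⟧),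
      InAdd T T₀ ∧ InAdd T T₁ ∧ Triangle.mk f g h ∈ distTriang C := by
  obtain ⟨n, g, hg⟩ := exists_biproduct_factorization k T X
  obtain ⟨T₁, f, h, hd⟩ := distinguished_cocone_triangle₁ g
  refine ⟨T₁, _, f, g, h, inAdd_biproduct T n, hT.2 T₁ fun φ => ?_, hd⟩
  obtain ⟨ψ, hψ⟩ : ∃ ψ : T ⟶ X, φ = ψ ≫ h :=
    Triangle.coyoneda_exact₁ _ hd φ (hT.1.eq_zero_of_biproduct _)
  obtain ⟨l, hl⟩ := hg ψ
  have hgh : g ≫ h = 0 := comp_distTriang_mor_zero₂₃ _ hd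
  rw [hψ, ← hl, Category.assoc, hgh, comp_zero]
end

section
/- Let C be as in the 2-Calabi–Yau setup, T a cluster-tilting object of C, and X an object of C. If T₁ → T₀ → X → ΣT₁ and T₁' → T₀' → X → ΣT₁' are two distinguished triangles with T₀, T₁, T₀', T₁' in add T, then T₀ ⊕ T₁' ≅ T₀' ⊕ T₁. (Equivalently, the index of X with respect to T is independent of the chosen add T-presentation triangle.) -/
/-!
STATEMENT 5 (Dehy–Keller): In the 2-Calabi–Yau setup, if `T` is a cluster-tilting
object and `T₁ → T₀ → X → ΣT₁`, `T₁' → T₀' → X → ΣT₁'` are two distinguished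
triangles with all outer terms in `add T`, then `T₀ ⊞ T₁' ≅ T₀' ⊞ T₁`.  (The index
of `X` with respect to `T` is well-defined.)

Krull–Schmidt is encoded as idempotent completeness, which, together with
Hom-finiteness over the field `k`, is equivalent to the Krull–Schmidt property.
-/
open CategoryTheory Limits Pretriangulated

universe v u

section Presentations

variable {C : Type u} [Category.{v} C] [Preadditive C] [HasZeroObject C]
  [HasShift C ℤ] [∀ n : ℤ, (shiftFunctor C n).Additive] [Pretriangulated C]
  [HasFiniteBiproducts C]

/-- An object of `add T` has an identity that is a finite sum of endomorphisms factoring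
through `T`. -/
lemma InAdd.exists_sum_comp_eq_id {T A : C} (hA : InAdd T A) :
    ∃ (n : ℕ) (a : Fin n → (A ⟶ T)) (b : Fin n → (T ⟶ A)), ∑ i, a i ≫ b i = 𝟙 A := by
  obtain ⟨n, Y, ⟨e⟩⟩ := hA
  refine ⟨n, fun i => biprod.inl ≫ e.hom ≫ biproduct.π _ i,
    fun i => biproduct.ι (fun _ : Fin n => T) i ≫ e.inv ≫ biprod.fst, ?_⟩
  calc
    _ = biprod.inl ≫ e.hom ≫
        (∑ i, biproduct.π (fun _ : Fin n => T) i ≫ biproduct.ι (fun _ : Fin n => T) i) ≫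
          e.inv ≫ biprod.fst := by
      simp only [Preadditive.sum_comp, Preadditive.comp_sum, Category.assoc]
    _ = 𝟙 A := by
      rw [biproduct.total]
      simp

/-- If `T` is rigid, there are no nonzero morphisms `A ⟶ ΣB` with `A`, `B` in `add T`. -/
lemma IsRigid.eq_zero_of_inAdd {T A B : C} (hT : IsRigid T)
    (hA : InAdd T A) (hB : InAdd T B) (φ : A ⟶ B⟦(1 : ℤ)⟧) : φ = 0 := by
  obtain ⟨n, a, b, hab⟩ := hA.exists_sum_comp_eq_id
  obtain ⟨m, c, d, hcd⟩ := hB.exists_sum_comp_eq_id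
  have hbφ (i : Fin n) : b i ≫ φ = 0 := by
    rw [← Category.comp_id (b i ≫ φ), ← (shiftFunctor C (1 : ℤ)).map_id, ← hcd,
      Functor.map_sum, Preadditive.comp_sum]
    refine Finset.sum_eq_zero fun j _ => ?_
    rw [Functor.map_comp, ← Category.assoc, hT ((b i ≫ φ) ≫ (c j)⟦(1 : ℤ)⟧'), zero_comp]
  rw [← Category.id_comp φ, ← hab, Preadditive.sum_comp]
  exact Finset.sum_eq_zero fun i _ => by rw [Category.assoc, hbφ, comp_zero]

/-- The product of a family indexed by `Bool` is the biproduct of its two members. -/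
noncomputable def piBoolIsoBiprod (F : Bool → C) :
    ∏ᶜ F ≅ F true ⊞ F false where
  hom := biprod.lift (Pi.π F true) (Pi.π F false)
  inv := Pi.lift fun | true => biprod.fst | false => biprod.snd
  hom_inv_id := Pi.hom_ext _ _ (by rintro (_ | _) <;> simp)
  inv_hom_id := by ext <;> simp

@[simp]
lemma piBoolIsoBiprod_hom_fst (F : Bool → C) :
    (piBoolIsoBiprod F).hom ≫ biprod.fst = Pi.π F true :=
  biprod.lift_fst _ _

/-- Adding the contractible triangle on `Z` to a distinguished triangle. -/
lemma exists_distinguished_biprod_desc_zero {T₁ T₀ X : C} {f : T₁ ⟶ T₀} {g : T₀ ⟶ X}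
    {h : X ⟶ T₁⟦(1 : ℤ)⟧} (htri : Triangle.mk f g h ∈ distTriang C) (Z : C) :
    ∃ (i : T₁ ⊞ Z ⟶ T₀ ⊞ Z) (δ : X ⟶ (T₁ ⊞ Z)⟦(1 : ℤ)⟧),
      Triangle.mk i (biprod.desc g 0) δ ∈ distTriang C := by
  let F : Bool → Triangle C := fun b => if b then Triangle.mk f g h else contractibleTriangle Z
  have hF : productTriangle F ∈ distTriang C := productTriangle_distinguished F (by
    rintro (_ | _)
    · exact contractible_distinguished Z
    · exact htri)
  let e₁ : ∏ᶜ (fun b => (F b).obj₁) ≅ T₁ ⊞ Z := piBoolIsoBiprod fun b => (F b).obj₁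
  let e₂ : ∏ᶜ (fun b => (F b).obj₂) ≅ T₀ ⊞ Z := piBoolIsoBiprod fun b => (F b).obj₂
  let e₃ : ∏ᶜ (fun b => (F b).obj₃) ≅ X :=
    (piBoolIsoBiprod fun b => (F b).obj₃) ≪≫ (isoBiprodZero (isZero_zero C)).symm
  refine ⟨e₁.inv ≫ (productTriangle F).mor₁ ≫ e₂.hom,
    e₃.inv ≫ (productTriangle F).mor₃ ≫ e₁.hom⟦(1 : ℤ)⟧', ?_⟩
  refine isomorphic_distinguished _ hF _ (Iso.symm (Triangle.isoMk _ _ e₁ e₂ e₃ ?_ ?_ ?_))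
  · exact (e₁.hom_inv_id_assoc _).symm
  · have h₁ : (productTriangle F).mor₂ ≫ e₃.hom = Pi.π (fun b => (F b).obj₂) true ≫ g :=
      (congrArg (fun p => (productTriangle F).mor₂ ≫ p) (piBoolIsoBiprod_hom_fst _)).trans
        (Pi.map_π (fun b => (F b).mor₂) true)
    have h₂ : e₂.hom ≫ biprod.desc g 0 = Pi.π (fun b => (F b).obj₂) true ≫ g := by
      have hg : biprod.desc g (0 : Z ⟶ X) = biprod.fst ≫ g := by ext <;> simp
      rw [hg, ← Category.assoc]
      exact congrArg (· ≫ g) (piBoolIsoBiprod_hom_fst _)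
    exact h₁.trans h₂.symm
  · exact (e₃.hom_inv_id_assoc _).symm

/-- Schanuel's lemma for triangles: if `g` and `g'` factor through each other, then the
middle and first terms of their triangles are stably interchangeable. -/
lemma nonempty_iso_of_factor {T₁ T₀ T₁' T₀' X : C}
    {f : T₁ ⟶ T₀} {g : T₀ ⟶ X} {h : X ⟶ T₁⟦(1 : ℤ)⟧}
    (htri : Triangle.mk f g h ∈ distTriang C)
    {f' : T₁' ⟶ T₀'} {g' : T₀' ⟶ X} {h' : X ⟶ T₁'⟦(1 : ℤ)⟧}
    (htri' : Triangle.mk f' g' h' ∈ distTriang C)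
    (a : T₀ ⟶ T₀') (ha : g = a ≫ g') (b : T₀' ⟶ T₀) (hb : g' = b ≫ g) :
    Nonempty ((T₁ ⊞ T₀') ≅ (T₁' ⊞ T₀)) := by
  obtain ⟨i, δ, hd⟩ := exists_distinguished_biprod_desc_zero htri T₀'
  obtain ⟨i', δ', hd'⟩ := exists_distinguished_biprod_desc_zero htri' T₀
  let s : T₀ ⊞ T₀' ≅ T₀ ⊞ T₀' :=
    { hom := biprod.desc biprod.inl (-b ≫ biprod.inl + biprod.inr)
      inv := biprod.desc biprod.inl (b ≫ biprod.inl + biprod.inr)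
      hom_inv_id := by ext <;> simp
      inv_hom_id := by ext <;> simp }
  let t : T₀ ⊞ T₀' ≅ T₀' ⊞ T₀ :=
    { hom := biprod.desc (a ≫ biprod.inl + biprod.inr) biprod.inl
      inv := biprod.desc biprod.inr (biprod.inl - a ≫ biprod.inr)
      hom_inv_id := by ext <;> simp
      inv_hom_id := by ext <;> simp }
  have hs : s.inv ≫ biprod.desc g 0 = biprod.desc g g' := by
    ext <;> simp [s, ← hb]
  have ht : t.hom ≫ biprod.desc g' 0 = biprod.desc g g' := by
    ext <;> simp [t, ← ha]
  have comm : biprod.desc g 0 = (s.hom ≫ t.hom) ≫ biprod.desc g' 0 := by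
    rw [Category.assoc, ht, ← hs, Iso.hom_inv_id_assoc]
  obtain ⟨c, hc₁, hc₂⟩ := complete_distinguished_triangle_morphism₁ _ _ hd hd'
    (s.hom ≫ t.hom) (𝟙 X) ((Category.comp_id _).trans comm)
  let φ : Triangle.mk i (biprod.desc g 0) δ ⟶ Triangle.mk i' (biprod.desc g' 0) δ' :=
    { hom₁ := c
      hom₂ := s.hom ≫ t.hom
      hom₃ := 𝟙 X
      comm₁ := hc₁
      comm₂ := (Category.comp_id _).trans comm
      comm₃ := hc₂ }
  have hφ : IsIso φ.hom₁ := isIso₁_of_isIso₂₃ φ hd hd'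
    (inferInstanceAs (IsIso (s ≪≫ t).hom)) (inferInstanceAs (IsIso (𝟙 X)))
  exact ⟨@asIso _ _ _ _ c hφ⟩

end Presentations

theorem index_well_defined
    (k : Type*) [Field k]
    (C : Type u) [Category.{v} C] [Preadditive C] [Linear k C] [HasZeroObject C]
    [HasShift C ℤ] [∀ n : ℤ, (shiftFunctor C n).Additive] [Pretriangulated C]
    [HasFiniteBiproducts C] [IsIdempotentComplete C]
    (hfd : ∀ X Y : C, FiniteDimensional k (X ⟶ Y))
    (cy : TwoCYStructure k C)
    (T : C) (hT : IsClusterTilting T)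
    (X : C)
    (T₁ T₀ : C) (f : T₁ ⟶ T₀) (g : T₀ ⟶ X) (h : X ⟶ T₁⟦(1 : ℤ)⟧)
    (hT₀ : InAdd T T₀) (hT₁ : InAdd T T₁)
    (htri : Triangle.mk f g h ∈ distTriang C)
    (T₁' T₀' : C) (f' : T₁' ⟶ T₀') (g' : T₀' ⟶ X) (h' : X ⟶ T₁'⟦(1 : ℤ)⟧)
    (hT₀' : InAdd T T₀') (hT₁' : InAdd T T₁')
    (htri' : Triangle.mk f' g' h' ∈ distTriang C) :
    Nonempty ((T₀ ⊞ T₁') ≅ (T₀' ⊞ T₁)) := by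
  obtain ⟨a, ha⟩ := Triangle.coyoneda_exact₃ _ htri' g (hT.1.eq_zero_of_inAdd hT₀ hT₁' _)
  obtain ⟨b, hb⟩ := Triangle.coyoneda_exact₃ _ htri g' (hT.1.eq_zero_of_inAdd hT₀' hT₁ _)
  obtain ⟨e⟩ := nonempty_iso_of_factor htri htri' a ha b hb
  exact ⟨biprod.braiding _ _ ≪≫ e.symm ≪≫ biprod.braiding _ _⟩
end

section
/- Let C be as in the 2-Calabi–Yau setup and T a cluster-tilting object of C. Let X and Y be rigid objects of C with add T-presentation triangles T₁^X → T₀^X → X → ΣT₁^X and T₁^Y → T₀^Y → Y → ΣT₁^Y (all four outer terms in add T). If T₀^X ⊕ T₁^Y ≅ T₀^Y ⊕ T₁^X (i.e., X and Y have the same index with respect to T), then X and Y are isomorphic. -/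
/-!
STATEMENT 6 (Dehy–Keller): In the 2-Calabi–Yau setup, if `T` is a cluster-tilting
object and `X`, `Y` are rigid objects with the same index with respect to `T`
(expressed via `add T`-presentation triangles as `T₀^X ⊞ T₁^Y ≅ T₀^Y ⊞ T₁^X`), then
`X ≅ Y`.

Krull–Schmidt is encoded as idempotent completeness, which, together with
Hom-finiteness over the field `k`, is equivalent to the Krull–Schmidt property.
-/
open CategoryTheory Limits Pretriangulated

universe v u

section Algebra

open Polynomial

variable {k Λ : Type*} [Field k] [Ring Λ] [Algebra k Λ]

/-- Some term of a sequence in a finite-dimensional space is a linear combination of the previous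
ones. -/
theorem exists_eq_sum_range_smul {M : Type*} [AddCommGroup M] [Module k M] [Module.Finite k M]
    (v : ℕ → M) : ∃ (n : ℕ) (c : ℕ → k), v n = ∑ j ∈ Finset.range n, c j • v j := by
  obtain ⟨n, hn⟩ := monotone_stabilizes_iff_noetherian.mpr (inferInstance : IsNoetherian k M)
    ⟨fun n => Submodule.span k (v '' (Finset.range n : Set ℕ)), fun a b hab =>
      Submodule.span_mono (Set.image_mono (Finset.coe_subset.mpr
        (Finset.range_subset_range.mpr hab)))⟩
  have h : v n ∈ Submodule.span k (v '' (Finset.range n : Set ℕ)) := by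
    have h1 := hn (n + 1) n.le_succ
    change Submodule.span k (v '' (Finset.range n : Set ℕ)) = Submodule.span k
      (v '' (Finset.range (n + 1) : Set ℕ)) at h1
    rw [h1]
    exact Submodule.subset_span ⟨n, by simp, rfl⟩
  rw [Submodule.mem_span_image_finset_iff_exists_fun] at h
  obtain ⟨c, hc⟩ := h
  refine ⟨n, fun j => if h : j ∈ Finset.range n then c ⟨j, h⟩ else 0, ?_⟩
  rw [← hc, ← Finset.sum_coe_sort (Finset.range n)]
  exact Finset.sum_congr rfl fun j _ => by simp only [dif_pos j.2]

/-- If the tangent map of the conjugation orbit of `f` surjects onto `V`, then `f + X * g` is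
conjugate to `f` by a polynomial with constant coefficient `1`, for every `g ∈ V`. -/
theorem exists_polynomial_intertwiner [Module.Finite k Λ] {e f g : Λ} {V : Submodule k Λ}
    (hV : ∀ v ∈ V, ∀ b, Commute e b → v * b ∈ V) (hg : g ∈ V)
    (hf : ∀ v ∈ V, ∃ b, Commute e b ∧ b * f - f * b = v) :
    ∃ u : Λ[X], Commute (C e) u ∧ u * C f = (C f + X * C g) * u ∧ u.coeff 0 = 1 := by
  choose! b hb hbf using hf
  let v : ℕ → Λ := fun n => Nat.rec g (fun _ w => g * b w) n
  have hv : ∀ n, v n ∈ V := fun n => by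
    induction n with
    | zero => exact hg
    | succ n ih => exact hV g hg _ (hb _ ih)
  obtain ⟨n, c, hc⟩ := exists_eq_sum_range_smul (k := k) v
  let W : ℕ → Λ[X] := fun j => 1 + ∑ i ∈ Finset.range j, X ^ (i + 1) * C (b (v i))
  have hWe : ∀ j, Commute (C e) (W j) := fun j =>
    (Commute.one_right _).add_right (Commute.sum_right _ _ _ fun i _ =>
      Commute.mul_right (X_pow_mul_C e (i + 1)).symm ((hb _ (hv i)).map C))
  have hW : ∀ j, W j * C f - (C f + X * C g) * W j = - (X ^ (j + 1) * C (v j)) := fun j => by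
    induction j with
    | zero => simp [W, v]
    | succ j ih =>
      have h1 : W (j + 1) = W j + X ^ (j + 1) * C (b (v j)) := by
        simp [W, Finset.sum_range_succ, add_assoc]
      have h2 : C (b (v j)) * C f - C f * C (b (v j)) = C (v j) := by
        rw [← C_mul, ← C_mul, ← C_sub, hbf _ (hv j)]
      have h3 : C (v (j + 1)) = C g * C (b (v j)) := by rw [← C_mul]
      have h4 : C f * X ^ (j + 1) = X ^ (j + 1) * C f := (X_pow_mul_C _ _).symm
      have h5 : C g * X ^ (j + 1) = X ^ (j + 1) * C g := (X_pow_mul_C _ _).symm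
      have h6 : W (j + 1) * C f - (C f + X * C g) * W (j + 1)
          = (W j * C f - (C f + X * C g) * W j)
            + X ^ (j + 1) * (C (b (v j)) * C f - C f * C (b (v j)))
            - X ^ (j + 2) * (C g * C (b (v j))) := by
        have h7 : (C f + X * C g) * (X ^ (j + 1) * C (b (v j)))
            = X ^ (j + 1) * (C f * C (b (v j))) + X ^ (j + 2) * (C g * C (b (v j))) := by
          rw [add_mul, ← mul_assoc, h4, mul_assoc, mul_assoc X, ← mul_assoc (C g), h5, mul_assoc,
            ← mul_assoc X, ← pow_succ']
        rw [h1, add_mul, mul_add, h7, mul_sub, mul_assoc]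
        abel
      rw [h6, ih, h2, ← h3]
      abel
  refine ⟨W n - ∑ j ∈ Finset.range n, X ^ (n - j) * (C (algebraMap k Λ (c j)) * W j), ?_, ?_, ?_⟩
  · refine (hWe n).sub_right (Commute.sum_right _ _ _ fun j _ =>
      Commute.mul_right (X_pow_mul_C e _).symm (Commute.mul_right ?_ (hWe j)))
    exact Commute.map (Algebra.commutes (c j) e).symm C
  · rw [← sub_eq_zero]
    have h1 : ∀ j ∈ Finset.range n, X ^ (n - j) * (C (algebraMap k Λ (c j)) * W j) * C f
        - (C f + X * C g) * (X ^ (n - j) * (C (algebraMap k Λ (c j)) * W j))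
        = - (X ^ (n + 1) * C (c j • v j)) := fun j hj => by
      have h2 : (C f + X * C g) * X ^ (n - j) = X ^ (n - j) * (C f + X * C g) :=
        (X_pow_mul (n := n - j) (p := C f + X * C g)).symm
      have h3 : (C f + X * C g) * C (algebraMap k Λ (c j))
          = C (algebraMap k Λ (c j)) * (C f + X * C g) := by
        have h4 : ∀ a : Λ, C a * C (algebraMap k Λ (c j)) = C (algebraMap k Λ (c j)) * C a :=
          fun a => by rw [← C_mul, ← C_mul, Algebra.commutes]
        rw [add_mul, mul_add, h4, mul_assoc, h4, ← mul_assoc, ← mul_assoc, X_mul_C]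
      have h5 : X ^ (n - j) * (C (algebraMap k Λ (c j)) * W j) * C f
        - (C f + X * C g) * (X ^ (n - j) * (C (algebraMap k Λ (c j)) * W j))
        = X ^ (n - j) * (C (algebraMap k Λ (c j)) *
            (W j * C f - (C f + X * C g) * W j)) := by
        rw [← mul_assoc (C f + X * C g), h2, mul_assoc, mul_assoc, mul_assoc _ (C f + X * C g),
          ← mul_assoc (C f + X * C g) (C _), h3, ← mul_sub, mul_assoc, ← mul_sub]
      have h6 : n + 1 = (n - j) + (j + 1) := by
        have := Finset.mem_range.mp hj
        omega
      rw [h5, hW, Algebra.smul_def, C_mul, h6, pow_add _ (n - j), mul_assoc (X ^ (n - j)),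
        ← mul_assoc (X ^ (j + 1)), X_pow_mul_C (algebraMap k Λ (c j)), mul_neg, mul_neg, mul_assoc]
    rw [sub_mul, mul_sub, Finset.sum_mul, Finset.mul_sum, sub_sub_sub_comm,
      ← Finset.sum_sub_distrib, Finset.sum_congr rfl h1, hW, hc, Finset.sum_neg_distrib, map_sum,
      Finset.mul_sum, sub_self]
  · have h1 : ∀ j ∈ Finset.range n,
        (X ^ (n - j) * (C (algebraMap k Λ (c j)) * W j)).coeff 0 = 0 := fun j hj => by
      have := Finset.mem_range.mp hj
      rw [mul_coeff_zero, coeff_X_pow, if_neg (by omega), zero_mul]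
    rw [coeff_sub, finsetSum_coeff, Finset.sum_eq_zero h1]
    simp [W, coeff_X_pow]

attribute [local instance] Polynomial.algebra

theorem Polynomial.finite_polynomial [Module.Finite k Λ] : Module.Finite k[X] Λ[X] := by
  obtain ⟨s, hs⟩ := (inferInstance : Module.Finite k Λ).fg_top
  classical
  refine ⟨⟨s.image C, Submodule.eq_top_iff'.mpr fun p => ?_⟩⟩
  induction p using Polynomial.induction_on' with
  | add p q hp hq => exact add_mem hp hq
  | monomial n a =>
    have ha : a ∈ Submodule.span k (s : Set Λ) := hs ▸ trivial
    induction ha using Submodule.span_induction with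
    | mem a ha =>
      have : monomial n a = (X ^ n : k[X]) • C a := by
        rw [Algebra.smul_def]; simp [C_mul_X_pow_eq_monomial, X_pow_mul_C]
      rw [this]
      exact Submodule.smul_mem _ _ (Submodule.subset_span
        (Finset.mem_coe.mpr (Finset.mem_image_of_mem C ha)))
    | zero => simp
    | add a b _ _ ha hb => rw [map_add]; exact add_mem ha hb
    | smul r a _ ha =>
      have : monomial n (r • a) = (C r : k[X]) • monomial n a := by
        rw [Algebra.smul_def]; simp [Algebra.smul_def, C_mul_monomial]
      rw [this]
      exact Submodule.smul_mem _ _ ha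

/-- A polynomial with constant coefficient `1` over a finite-dimensional algebra becomes right
invertible after inverting a nonzero central polynomial. -/
theorem exists_mul_eq_map [Module.Finite k Λ] {u : Λ[X]} (hu : u.coeff 0 = 1) :
    ∃ p : k[X], p ≠ 0 ∧ ∃ w : Λ[X], u * w = p.map (algebraMap k Λ) := by
  have := Polynomial.finite_polynomial (k := k) (Λ := Λ)
  have hreg : ∀ w : Λ[X], u * w = 0 → w = 0 := fun w hw => by
    by_contra hne
    have h := congrArg (fun q => coeff q w.natTrailingDegree) hw
    rw [coeff_mul, coeff_zero] at h
    rw [Finset.sum_eq_single (0, w.natTrailingDegree)] at h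
    · rw [hu, one_mul] at h
      exact hne (trailingCoeff_eq_zero.mp h)
    · rintro ⟨i, j⟩ hij hne'
      have hij := Finset.HasAntidiagonal.mem_antidiagonal.mp hij
      dsimp only at hij ⊢
      rw [coeff_eq_zero_of_lt_natTrailingDegree (n := j), mul_zero]
      rcases Nat.eq_zero_or_pos i with rfl | hi
      · exact absurd (by rw [← hij, zero_add]) hne'
      · omega
    · simp
  obtain ⟨P, hP, hPu⟩ := (IsIntegral.of_finite k[X] u)
  have hex : ∀ (n : ℕ) (P : k[X][X]), P.natDegree ≤ n → P ≠ 0 → aeval u P = 0 →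
      ∃ p : k[X], p ≠ 0 ∧ ∃ w : Λ[X], u * w = p.map (algebraMap k Λ) := by
    intro n
    induction n with
    | zero =>
      intro P hn hP0 h
      rw [Polynomial.eq_C_of_natDegree_le_zero hn] at h hP0
      refine ⟨P.coeff 0, fun h0 => hP0 (by rw [h0, C_0]), 0, ?_⟩
      simpa using h.symm
    | succ n ih =>
      intro P hn hP0 h
      have hdiv : aeval u P = u * aeval u P.divX + (P.coeff 0).map (algebraMap k Λ) := by
        have h1 := congrArg (aeval u) (X_mul_divX_add P).symm
        rwa [map_add, map_mul, aeval_X, aeval_C] at h1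
      by_cases h0 : P.coeff 0 = 0
      · refine ih P.divX ?_ ?_ (hreg _ ?_)
        · rw [natDegree_divX_eq_natDegree_tsub_one]; omega
        · intro hd
          apply hP0
          rw [← X_mul_divX_add P, hd, h0]; simp
        · rw [h, h0] at hdiv
          simpa using hdiv.symm
      · refine ⟨-P.coeff 0, neg_ne_zero.mpr h0, aeval u P.divX, ?_⟩
        rw [h] at hdiv
        rw [Polynomial.map_neg, eq_neg_iff_add_eq_zero, ← hdiv]
  exact hex _ P le_rfl hP.ne_zero hPu

theorem isUnit_of_mul_eq_one_of_finite (k : Type*) {R : Type*} [Field k] [Ring R] [Algebra k R]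
    [Module.Finite k R] {a b : R} (h : a * b = 1) : IsUnit a := by
  have : IsArtinianRing R := .of_finite k R
  exact .of_mul_eq_one b h

section Matrices

variable {ι : Type*} [Fintype ι] [DecidableEq ι]

/-- Evaluation of polynomials over `Λ` at a matrix with central entries. -/
noncomputable def evalMatrix (Λ : Type*) [Ring Λ] [Algebra k Λ] (τ : Matrix ι ι k) :
    Λ[X] →+* Matrix ι ι Λ :=
  eval₂RingHom' (Matrix.scalar ι) (τ.map (algebraMap k Λ)) fun a => by
    ext i j
    simp [Matrix.scalar_apply, Algebra.commutes]

@[simp] theorem evalMatrix_C (τ : Matrix ι ι k) (a : Λ) :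
    evalMatrix Λ τ (C a) = Matrix.scalar ι a :=
  eval₂_C _ _

@[simp] theorem evalMatrix_X (τ : Matrix ι ι k) :
    evalMatrix Λ τ X = τ.map (algebraMap k Λ) :=
  eval₂_X _ _

theorem evalMatrix_map (τ : Matrix ι ι k) (p : k[X]) :
    evalMatrix Λ τ (p.map (algebraMap k Λ)) = (algebraMap k Λ).mapMatrix (aeval τ p) := by
  have : (evalMatrix Λ τ).comp (mapRingHom (algebraMap k Λ)) =
      ((algebraMap k Λ).mapMatrix).comp (aeval τ : k[X] →ₐ[k] Matrix ι ι k).toRingHom := by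
    refine Polynomial.ringHom_ext (fun a => ?_) ?_
    · ext i j
      by_cases h : i = j <;>
        simp [Matrix.algebraMap_matrix_apply, h]
    · ext i j
      simp
  exact congrArg (fun φ : k[X] →+* Matrix ι ι Λ => φ p) this

end Matrices

/-- Outside the zeros of a nonzero polynomial, `f + τ g` is conjugate to `f` in matrices
over `Λ`. -/
theorem exists_matrix_intertwiner [Module.Finite k Λ] {e f g : Λ} {V : Submodule k Λ}
    (hV : ∀ v ∈ V, ∀ b, Commute e b → v * b ∈ V) (hg : g ∈ V)
    (hf : ∀ v ∈ V, ∃ b, Commute e b ∧ b * f - f * b = v) :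
    ∃ p : k[X], p ≠ 0 ∧ ∀ (d : ℕ) (τ : Matrix (Fin d) (Fin d) k), IsUnit (aeval τ p) →
      ∃ U : (Matrix (Fin d) (Fin d) Λ)ˣ, Commute (Matrix.scalar (Fin d) e) U ∧
        U * Matrix.scalar (Fin d) f =
          (Matrix.scalar (Fin d) f + τ.map (algebraMap k Λ) * Matrix.scalar (Fin d) g) * U := by
  obtain ⟨u, hue, huf, hu⟩ := exists_polynomial_intertwiner hV hg hf
  obtain ⟨p, hp, w, hw⟩ := exists_mul_eq_map (k := k) hu
  refine ⟨p, hp, fun d τ hτ => ?_⟩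
  have h1 : IsUnit (evalMatrix Λ τ u * evalMatrix Λ τ w) := by
    rw [← map_mul, hw, evalMatrix_map]
    exact hτ.map _
  obtain ⟨z, hz⟩ := h1.exists_right_inv
  rw [mul_assoc] at hz
  have h2 := isUnit_of_mul_eq_one_of_finite k hz
  refine ⟨h2.unit, ?_, ?_⟩
  · simpa using hue.map (evalMatrix Λ τ)
  · simpa only [map_mul, map_add, evalMatrix_C, evalMatrix_X, IsUnit.unit_spec] using
      congrArg (evalMatrix Λ τ) huf

/-- Two elements of `V` whose tangent maps surject onto `V` are conjugate over matrices, outside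
the zeros of a nonzero polynomial. -/
theorem exists_matrix_conj [Module.Finite k Λ] {e f f' : Λ} {V : Submodule k Λ}
    (hV : ∀ v ∈ V, ∀ b, Commute e b → v * b ∈ V) (hfV : f ∈ V) (hfV' : f' ∈ V)
    (hf : ∀ v ∈ V, ∃ b, Commute e b ∧ b * f - f * b = v)
    (hf' : ∀ v ∈ V, ∃ b, Commute e b ∧ b * f' - f' * b = v) :
    ∃ p : k[X], p ≠ 0 ∧ ∀ (d : ℕ) (τ : Matrix (Fin d) (Fin d) k), IsUnit (aeval τ p) →
      ∃ U : (Matrix (Fin d) (Fin d) Λ)ˣ, Commute (Matrix.scalar (Fin d) e) U ∧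
        U * Matrix.scalar (Fin d) f = Matrix.scalar (Fin d) f' * U := by
  obtain ⟨p, hp, h⟩ := exists_matrix_intertwiner hV (sub_mem hfV' hfV) hf
  obtain ⟨p', hp', h'⟩ := exists_matrix_intertwiner hV (sub_mem hfV hfV') hf'
  refine ⟨p * p'.comp (1 - X), mul_ne_zero hp ?_, fun d τ hτ => ?_⟩
  · intro h0
    apply hp'
    have h1 : (p'.comp (1 - X)).comp (1 - X) = p' := by simp [comp_assoc]
    rw [← h1, h0, Polynomial.zero_comp]
  rw [map_mul] at hτ
  have hcomm : aeval τ p * aeval τ (p'.comp (1 - X)) = aeval τ (p'.comp (1 - X)) * aeval τ p := by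
    rw [← map_mul, ← map_mul, mul_comm]
  obtain ⟨h1, h2⟩ := (Commute.isUnit_mul_iff hcomm).mp hτ
  rw [aeval_comp, map_sub, map_one, aeval_X] at h2
  obtain ⟨U, hUe, hU⟩ := h d τ h1
  obtain ⟨U', hUe', hU'⟩ := h' d (1 - τ) h2
  have h3 : Matrix.scalar (Fin d) f' +
      (1 - τ).map (algebraMap k Λ) * Matrix.scalar (Fin d) (f - f') =
      Matrix.scalar (Fin d) f + τ.map (algebraMap k Λ) * Matrix.scalar (Fin d) (f' - f) := by
    have h4 : (1 - τ).map (algebraMap k Λ) = 1 - τ.map (algebraMap k Λ) := by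
      simpa using map_sub (algebraMap k Λ).mapMatrix 1 τ
    rw [h4, map_sub, map_sub]
    noncomm_ring
  rw [h3] at hU'
  refine ⟨U'⁻¹ * U, ?_, ?_⟩
  · rw [Units.val_mul]
    exact (hUe'.units_inv_right).mul_right hUe
  · rw [Units.val_mul, mul_assoc, hU, Units.inv_mul_eq_iff_eq_mul, ← mul_assoc, ← mul_assoc, hU',
      Units.mul_inv_cancel_right]

/-- Möbius inversion for counting: the fibres of a map to a finite poset are determined by the
preimages of lower sets. -/
theorem card_fiber_eq_of_card_le_eq {α P : Type*} [PartialOrder P] [Finite P] [DecidableEq P]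
    [DecidableLE P] (π : α → P) (A B : Finset α)
    (h : ∀ S, (A.filter (π · ≤ S)).card = (B.filter (π · ≤ S)).card) (S : P) :
    (A.filter (π · = S)).card = (B.filter (π · = S)).card := by
  classical
  have := Fintype.ofFinite P
  induction S using WellFoundedLT.induction with
  | ind S ih =>
  have key : ∀ D : Finset α, (D.filter (π · ≤ S)).card =
      ∑ S' ∈ Finset.univ.filter (· < S), (D.filter (π · = S')).card +
        (D.filter (π · = S)).card := fun D => by
    have h1 : (Finset.univ.filter (· ≤ S)) = insert S (Finset.univ.filter (· < S)) := by
      ext x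
      simp [le_iff_eq_or_lt]
    rw [add_comm, ← Finset.sum_insert (by simp) (f := fun S' => (D.filter (π · = S')).card), ← h1,
      Finset.card_eq_sum_card_fiberwise (f := π) (t := Finset.univ.filter (· ≤ S))
        (fun x hx => by simpa using (Finset.mem_filter.mp hx).2)]
    refine Finset.sum_congr rfl fun S' hS' => ?_
    rw [Finset.filter_filter]
    refine congrArg _ (Finset.filter_congr fun x _ => ⟨fun hx => hx.2, fun hx => ⟨?_, hx⟩⟩)
    rw [hx]
    exact (Finset.mem_filter.mp hS').2
  have h2 := h S
  rw [key, key, Finset.sum_congr rfl fun S' hS' => ih S' (Finset.mem_filter.mp hS').2] at h2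
  exact Nat.add_left_cancel h2

/-- Over a finite algebra, elements that are conjugate over matrices are conjugate. -/
theorem exists_conj_of_matrix_conj [Finite Λ] {e f f' : Λ} {d : ℕ} (hd : d ≠ 0)
    (U : (Matrix (Fin d) (Fin d) Λ)ˣ)
    (hUe : Commute (Matrix.scalar (Fin d) e) (U : Matrix (Fin d) (Fin d) Λ))
    (hU : U * Matrix.scalar (Fin d) f = Matrix.scalar (Fin d) f' * U) :
    ∃ u : Λˣ, Commute e u ∧ u * f = f' * u := by
  classical
  have := Fintype.ofFinite Λ
  let A : Finset Λ := Finset.univ.filter fun x => Commute e x ∧ x * f = f' * x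
  let B : Finset Λ := Finset.univ.filter fun x => Commute e x ∧ x * f' = f' * x
  let π : Λ → Submodule Λᵐᵒᵖ Λ := fun x => Submodule.span Λᵐᵒᵖ {x}
  have hmem : ∀ (S : Submodule Λᵐᵒᵖ Λ) (M : Matrix (Fin d) (Fin d) Λ) (x : Fin d → Λ),
      (∀ i, x i ∈ S) → ∀ j, Matrix.vecMul x M j ∈ S := fun S M x hx j => by
    simp only [Matrix.vecMul, dotProduct]
    exact Submodule.sum_mem _ fun i _ => S.smul_mem (MulOpposite.op (M i j)) (hx i)
  have hcomm : ∀ (M : Matrix (Fin d) (Fin d) Λ) (x : Fin d → Λ),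
      Commute (Matrix.scalar (Fin d) e) M → (∀ i, Commute e (x i)) →
      ∀ j, Commute e (Matrix.vecMul x M j) := fun M x hM hx j => by
    simp only [Matrix.vecMul, dotProduct]
    refine Commute.sum_right _ _ _ fun i _ => (hx i).mul_right ?_
    simpa [Commute, SemiconjBy] using congrFun (congrFun hM.eq i) j
  have hint : ∀ (M : Matrix (Fin d) (Fin d) Λ) (x : Fin d → Λ) (a b : Λ),
      M * Matrix.scalar (Fin d) b = Matrix.scalar (Fin d) a * M → (∀ i, x i * a = f' * x i) →
      ∀ j, Matrix.vecMul x M j * b = f' * Matrix.vecMul x M j := fun M x a b hM hx j => by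
    simp only [Matrix.vecMul, dotProduct, Finset.sum_mul, Finset.mul_sum]
    refine Finset.sum_congr rfl fun i _ => ?_
    have h1 : M i j * b = a * M i j := by simpa using congrFun (congrFun hM i) j
    rw [mul_assoc, h1, ← mul_assoc, hx, mul_assoc]
  have hUe' : Commute (Matrix.scalar (Fin d) e) (↑U⁻¹ : Matrix (Fin d) (Fin d) Λ) :=
    hUe.units_inv_right
  have hU' : (↑U⁻¹ : Matrix (Fin d) (Fin d) Λ) * Matrix.scalar (Fin d) f' =
      Matrix.scalar (Fin d) f * (↑U⁻¹ : Matrix (Fin d) (Fin d) Λ) := by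
    rw [Units.inv_mul_eq_iff_eq_mul, ← mul_assoc, hU, Units.mul_inv_cancel_right]
  have hcard : ∀ S, (A.filter (π · ≤ S)).card = (B.filter (π · ≤ S)).card := fun S => by
    have e : (Fin d → A.filter (π · ≤ S)) ≃ (Fin d → B.filter (π · ≤ S)) :=
      { toFun := fun x j => ⟨Matrix.vecMul (fun i => (x i : Λ)) ↑U⁻¹ j, by
          have hx := fun i => (x i).2
          simp only [A, B, π, Finset.mem_filter, Finset.mem_univ, true_and,
            Submodule.span_singleton_le_iff_mem] at hx ⊢
          exact ⟨⟨hcomm _ _ hUe' (fun i => (hx i).1.1) j,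
            hint _ _ _ _ hU' (fun i => (hx i).1.2) j⟩, hmem S _ _ (fun i => (hx i).2) j⟩⟩
        invFun := fun x j => ⟨Matrix.vecMul (fun i => (x i : Λ)) ↑U j, by
          have hx := fun i => (x i).2
          simp only [A, B, π, Finset.mem_filter, Finset.mem_univ, true_and,
            Submodule.span_singleton_le_iff_mem] at hx ⊢
          exact ⟨⟨hcomm _ _ hUe (fun i => (hx i).1.1) j,
            hint _ _ _ _ hU (fun i => (hx i).1.2) j⟩, hmem S _ _ (fun i => (hx i).2) j⟩⟩
        left_inv := fun x => by
          ext j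
          simp
        right_inv := fun x => by
          ext j
          simp }
    have h1 := Nat.card_congr e
    rw [Nat.card_fun, Nat.card_fun, Nat.card_fin, Nat.card_eq_fintype_card,
      Nat.card_eq_fintype_card, Fintype.card_coe, Fintype.card_coe] at h1
    exact Nat.pow_left_injective hd h1
  have h1 := card_fiber_eq_of_card_le_eq π A B hcard (π 1)
  have h2 : 0 < (B.filter (π · = π 1)).card :=
    Finset.card_pos.mpr ⟨1, by simp [B]⟩
  rw [← h1] at h2
  obtain ⟨x, hx⟩ := Finset.card_pos.mp h2
  simp only [A, Finset.mem_filter, Finset.mem_univ, true_and] at hx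
  have h3 : (1 : Λ) ∈ π x := hx.2 ▸ Submodule.mem_span_singleton_self 1
  obtain ⟨y, hy⟩ := Submodule.mem_span_singleton.mp h3
  have hxu : IsUnit x := .of_mul_eq_one y.unop hy
  exact ⟨hxu.unit, hx.1⟩

theorem exists_matrix_isUnit_aeval_of_aeval_ne_zero {F : Type*} [Field F] [Algebra k F]
    [Module.Finite k F] {p : k[X]} {x : F} (hx : aeval x p ≠ 0) :
    ∃ τ : Matrix (Fin (Module.finrank k F)) (Fin (Module.finrank k F)) k,
      IsUnit (aeval τ p) := by
  refine ⟨Algebra.leftMulMatrix (Module.finBasis k F) x, ?_⟩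
  rw [aeval_algHom_apply]
  exact (isUnit_iff_ne_zero.mpr hx).map _

theorem exists_aeval_ne_zero (F : Type*) [Field F] [Infinite F] [Algebra k F] {p : k[X]}
    (hp : p ≠ 0) : ∃ x : F, aeval x p ≠ 0 := by
  by_contra! h
  refine hp ((Polynomial.map_eq_zero (algebraMap k F)).mp (Polynomial.funext fun x => ?_))
  rw [eval_map_algebraMap, h, eval_zero]

/-- Every nonzero polynomial over a field is invertible at some square matrix; over an infinite
field this matrix can be taken of size one. -/
theorem exists_matrix_isUnit_aeval {p : k[X]} (hp : p ≠ 0) :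
    ∃ (d : ℕ) (τ : Matrix (Fin d) (Fin d) k), d ≠ 0 ∧ (Infinite k → d = 1) ∧
      IsUnit (aeval τ p) := by
  by_cases hk : Infinite k
  · obtain ⟨x, hx⟩ := exists_aeval_ne_zero k hp
    obtain ⟨τ, hτ⟩ := exists_matrix_isUnit_aeval_of_aeval_ne_zero hx
    exact ⟨_, τ, by simp, by simp, hτ⟩
  · have : Infinite (AlgebraicClosure k) := inferInstance
    obtain ⟨x, hx⟩ := exists_aeval_ne_zero (AlgebraicClosure k) hp
    have := IntermediateField.adjoin.finiteDimensional (Algebra.IsIntegral.isIntegral (R := k) x)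
    have hx' : aeval (IntermediateField.AdjoinSimple.gen k x) p ≠ 0 := fun h => hx (by
      have h1 := congrArg (algebraMap _ (AlgebraicClosure k)) h
      rwa [← aeval_algebraMap_apply, IntermediateField.AdjoinSimple.algebraMap_gen,
        map_zero] at h1)
    obtain ⟨τ, hτ⟩ := exists_matrix_isUnit_aeval_of_aeval_ne_zero hx'
    exact ⟨_, τ, Module.finrank_pos.ne', fun h => absurd h hk, hτ⟩

/-- In a finite-dimensional algebra, two elements of `V` whose tangent maps surject onto `V` are
conjugate by a unit of the centralizer of `e`. -/
theorem exists_unit_conj [Module.Finite k Λ] {e f f' : Λ} {V : Submodule k Λ}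
    (hV : ∀ v ∈ V, ∀ b, Commute e b → v * b ∈ V) (hfV : f ∈ V) (hfV' : f' ∈ V)
    (hf : ∀ v ∈ V, ∃ b, Commute e b ∧ b * f - f * b = v)
    (hf' : ∀ v ∈ V, ∃ b, Commute e b ∧ b * f' - f' * b = v) :
    ∃ u : Λˣ, Commute e u ∧ u * f = f' * u := by
  obtain ⟨p, hp, h⟩ := exists_matrix_conj hV hfV hfV' hf hf'
  obtain ⟨d, τ, hd, hd1, hτ⟩ := exists_matrix_isUnit_aeval hp
  obtain ⟨U, hUe, hU⟩ := h d τ hτ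
  by_cases hk : Infinite k
  · obtain rfl := hd1 hk
    have entry : ∀ M : Matrix (Fin 1) (Fin 1) Λ, ∀ N : Matrix (Fin 1) (Fin 1) Λ,
        (M * N) 0 0 = M 0 0 * N 0 0 := fun M N => by simp [Matrix.mul_apply]
    have h1 := congrFun (congrFun U.mul_inv 0) 0
    have h2 := congrFun (congrFun U.inv_mul 0) 0
    have h3 := congrFun (congrFun hU 0) 0
    have h4 := congrFun (congrFun hUe.eq 0) 0
    rw [entry] at h1 h2
    rw [entry, entry] at h3 h4
    exact ⟨⟨_, _, h1, h2⟩, by simpa [Commute, SemiconjBy] using h4, by simpa using h3⟩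
  · have : Finite k := not_infinite_iff_finite.mp hk
    have : Finite Λ := Module.finite_of_finite k
    exact exists_conj_of_matrix_conj hd U hUe hU

end Algebra

theorem IsRigid.of_iso {C : Type u} [Category.{v} C] [Preadditive C] [HasShift C ℤ]
    {X Y : C} (e : X ≅ Y) (hX : IsRigid X) : IsRigid Y := fun f => by
  have h := hX (e.hom ≫ f ≫ e.inv⟦1⟧')
  rwa [← cancel_epi e.hom, ← cancel_mono (e.inv⟦(1 : ℤ)⟧'), comp_zero, zero_comp, Category.assoc]

theorem id_shift_biprod {C : Type u} [Category.{v} C] [Preadditive C] [HasShift C ℤ]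
    [∀ n : ℤ, (shiftFunctor C n).Additive] (P Q : C) [HasBinaryBiproduct P Q] (n : ℤ) :
    𝟙 ((P ⊞ Q)⟦n⟧) = biprod.fst⟦n⟧' ≫ biprod.inl⟦n⟧' + biprod.snd⟦n⟧' ≫ biprod.inr⟦n⟧' := by
  rw [← Functor.map_comp, ← Functor.map_comp, ← Functor.map_add, biprod.total,
    CategoryTheory.Functor.map_id]

section Triangulated

variable {C : Type u} [Category.{v} C] [Preadditive C] [HasZeroObject C]
  [HasShift C ℤ] [∀ n : ℤ, (shiftFunctor C n).Additive] [Pretriangulated C]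

/-- For a presentation of a rigid object, the tangent map of the action of automorphisms on the
space of presentations is surjective. -/
theorem IsRigid.exists_eq_comp_sub_comp {P₁ P₀ X : C} {f : P₁ ⟶ P₀} {g : P₀ ⟶ X}
    {h : X ⟶ P₁⟦(1 : ℤ)⟧} (hX : IsRigid X) (htri : Triangle.mk f g h ∈ distTriang C)
    (h₀₁ : ∀ φ : P₀ ⟶ P₁⟦(1 : ℤ)⟧, φ = 0) (w : P₁ ⟶ P₀) :
    ∃ (a : P₀ ⟶ P₀) (b : P₁ ⟶ P₁), f ≫ a - b ≫ f = w := by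
  obtain ⟨c, hc⟩ : ∃ c : P₀⟦(1 : ℤ)⟧ ⟶ X⟦(1 : ℤ)⟧, (w ≫ g)⟦(1 : ℤ)⟧' = (-f⟦(1 : ℤ)⟧') ≫ c :=
    Triangle.yoneda_exact₃ _ (rot_of_distTriang _ htri) ((w ≫ g)⟦(1 : ℤ)⟧')
      (hX (h ≫ (w ≫ g)⟦(1 : ℤ)⟧'))
  obtain ⟨c, rfl⟩ := (shiftFunctor C (1 : ℤ)).map_surjective c
  have hc' : w ≫ g = f ≫ (-c) := (shiftFunctor C (1 : ℤ)).map_injective (by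
    rw [hc, Functor.map_comp, Functor.map_neg, Preadditive.neg_comp, Preadditive.comp_neg])
  obtain ⟨a, ha⟩ : ∃ a : P₀ ⟶ P₀, -c = a ≫ g := Triangle.coyoneda_exact₃ _ htri (-c) (h₀₁ _)
  have hwa : (w - f ≫ a) ≫ g = 0 := by
    rw [Preadditive.sub_comp, Category.assoc, ← ha, hc', sub_self]
  obtain ⟨b, hb⟩ : ∃ b : P₁ ⟶ P₁, w - f ≫ a = b ≫ f :=
    Triangle.coyoneda_exact₂ _ htri (w - f ≫ a) hwa
  refine ⟨a, -b, ?_⟩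
  rw [Preadditive.neg_comp, ← hb]
  abel

/-- Two presentations with the same terms of rigid objects have isomorphic cones. -/
theorem IsRigid.nonempty_iso_of_presentations (k : Type*) [Field k] [Linear k C]
    (hfd : ∀ X Y : C, FiniteDimensional k (X ⟶ Y)) {P₁ P₀ X Y : C} {f f' : P₁ ⟶ P₀}
    {g : P₀ ⟶ X} {h : X ⟶ P₁⟦(1 : ℤ)⟧} {g' : P₀ ⟶ Y} {h' : Y ⟶ P₁⟦(1 : ℤ)⟧}
    (hX : IsRigid X) (hY : IsRigid Y) (htri : Triangle.mk f g h ∈ distTriang C)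
    (htri' : Triangle.mk f' g' h' ∈ distTriang C) (h₀₁ : ∀ φ : P₀ ⟶ P₁⟦(1 : ℤ)⟧, φ = 0) :
    Nonempty (X ≅ Y) := by
  have : Module.Finite k (End (P₁ ⊞ P₀)) := hfd _ _
  let e : End (P₁ ⊞ P₀) := biprod.fst ≫ biprod.inl
  let L : (P₁ ⟶ P₀) →ₗ[k] End (P₁ ⊞ P₀) :=
    Linear.leftComp k (P₁ ⊞ P₀) (biprod.fst : P₁ ⊞ P₀ ⟶ P₁) ∘ₗ
      Linear.rightComp k P₁ (biprod.inr : P₀ ⟶ P₁ ⊞ P₀)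
  have hL : ∀ w, L w = biprod.fst ≫ w ≫ biprod.inr := fun _ => rfl
  have hcomm : ∀ b : End (P₁ ⊞ P₀), Commute e b →
      biprod.fst ≫ biprod.inl ≫ b = b ≫ biprod.fst ≫ biprod.inl := fun b hb => by
    simpa [e, End.mul_def] using hb.eq.symm
  have htangent : ∀ F : P₁ ⟶ P₀,
      (∀ w : P₁ ⟶ P₀, ∃ (a : P₀ ⟶ P₀) (b : P₁ ⟶ P₁), F ≫ a - b ≫ F = w) →
      ∀ w ∈ LinearMap.range L, ∃ b, Commute e b ∧ b * L F - L F * b = w := by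
    rintro F hF _ ⟨w, rfl⟩
    obtain ⟨a, b, rfl⟩ := hF w
    refine ⟨biprod.map b a, ?_, ?_⟩
    · exact biprod.hom_ext' _ _ (by simp [e, End.mul_def]) (by simp [e, End.mul_def])
    · simp [hL, End.mul_def]
  obtain ⟨u, hue, huf⟩ := exists_unit_conj (k := k) (e := e) (f := L f) (f' := L f')
    (V := LinearMap.range L) (by
      rintro _ ⟨w, rfl⟩ b hb
      refine ⟨biprod.inl ≫ b ≫ biprod.fst ≫ w, ?_⟩
      have h1 := hcomm b hb =≫ biprod.fst
      simp only [Category.assoc, biprod.inl_fst, Category.comp_id] at h1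
      simp only [hL, End.mul_def, Category.assoc]
      exact (reassoc_of% h1) _)
    ⟨f, rfl⟩ ⟨f', rfl⟩ (htangent f (hX.exists_eq_comp_sub_comp htri h₀₁))
    (htangent f' (hY.exists_eq_comp_sub_comp htri' h₀₁))
  have hue' : Commute e (↑u⁻¹ : End (P₁ ⊞ P₀)) := hue.units_inv_right
  have h₁ : (u : End (P₁ ⊞ P₀)) ≫ (↑u⁻¹ : End (P₁ ⊞ P₀)) = 𝟙 _ := u.inv_mul
  have h₂ : (↑u⁻¹ : End (P₁ ⊞ P₀)) ≫ (u : End (P₁ ⊞ P₀)) = 𝟙 _ := u.mul_inv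
  have huf' : biprod.fst ≫ f ≫ biprod.inr ≫ (u : End (P₁ ⊞ P₀)) =
      (u : End (P₁ ⊞ P₀)) ≫ biprod.fst ≫ f' ≫ biprod.inr := by
    simpa [hL, End.mul_def] using huf
  have hfst : ∀ b b' : End (P₁ ⊞ P₀), Commute e b → b ≫ b' = 𝟙 _ →
      (biprod.inl ≫ b ≫ biprod.fst) ≫ biprod.inl ≫ b' ≫ biprod.fst = 𝟙 P₁ := fun b b' hb h => by
    have h1 := biprod.inl ≫= hcomm b hb
    simp only [biprod.inl_fst_assoc] at h1
    simp only [Category.assoc]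
    rw [← reassoc_of% h1, reassoc_of% h]
    simp
  have hsnd : ∀ b b' : End (P₁ ⊞ P₀), Commute e b → b ≫ b' = 𝟙 _ →
      (biprod.inr ≫ b ≫ biprod.snd) ≫ biprod.inr ≫ b' ≫ biprod.snd = 𝟙 P₀ := fun b b' hb h => by
    have h1 := biprod.inr ≫= hcomm b hb
    simp only [biprod.inr_fst_assoc, zero_comp] at h1
    have h2 : (biprod.snd : P₁ ⊞ P₀ ⟶ _) ≫ biprod.inr = 𝟙 _ - biprod.fst ≫ biprod.inl := by
      rw [eq_sub_iff_add_eq', biprod.total]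
    simp only [Category.assoc]
    rw [reassoc_of% h2, Preadditive.sub_comp, Preadditive.comp_sub, Preadditive.comp_sub,
      Category.assoc, ← reassoc_of% h1, zero_comp, sub_zero, Category.id_comp, reassoc_of% h]
    simp
  let α : P₁ ≅ P₁ := ⟨biprod.inl ≫ (u : End (P₁ ⊞ P₀)) ≫ biprod.fst,
    biprod.inl ≫ (↑u⁻¹ : End (P₁ ⊞ P₀)) ≫ biprod.fst, hfst _ _ hue h₁, hfst _ _ hue' h₂⟩
  let β : P₀ ≅ P₀ := ⟨biprod.inr ≫ (u : End (P₁ ⊞ P₀)) ≫ biprod.snd,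
    biprod.inr ≫ (↑u⁻¹ : End (P₁ ⊞ P₀)) ≫ biprod.snd, hsnd _ _ hue h₁, hsnd _ _ hue' h₂⟩
  have h₃ : f ≫ β.hom = α.hom ≫ f' := by
    have := biprod.inl ≫= huf' =≫ biprod.snd
    simpa [α, β] using this
  exact ⟨Triangle.π₃.mapIso (isoTriangleOfIso₁₂ _ _ htri htri' α β h₃)⟩

/-- Adding a contractible summand to a presentation does not change its cone. -/
theorem exists_distinguished_biprod_map_id {P₁ P₀ X : C} {f : P₁ ⟶ P₀} {g : P₀ ⟶ X}
    {h : X ⟶ P₁⟦(1 : ℤ)⟧} (htri : Triangle.mk f g h ∈ distTriang C) (Z : C) :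
    ∃ (W : C) (_ : X ≅ W) (g' : P₀ ⊞ Z ⟶ W) (h' : W ⟶ (P₁ ⊞ Z)⟦(1 : ℤ)⟧),
      Triangle.mk (biprod.map f (𝟙 Z)) g' h' ∈ distTriang C := by
  obtain ⟨W, G, H, hW⟩ := distinguished_cocone_triangle (biprod.map f (𝟙 Z))
  obtain ⟨φ, hφ₂, hφ₃⟩ : ∃ φ : W ⟶ X, G ≫ φ = biprod.fst ≫ g ∧
      H ≫ biprod.fst⟦(1 : ℤ)⟧' = φ ≫ h :=
    complete_distinguished_triangle_morphism _ _ hW htri biprod.fst biprod.fst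
      (biprod.map_fst f (𝟙 Z))
  obtain ⟨ψ, hψ₂, hψ₃⟩ : ∃ ψ : X ⟶ W, g ≫ ψ = biprod.inl ≫ G ∧
      h ≫ biprod.inl⟦(1 : ℤ)⟧' = ψ ≫ H :=
    complete_distinguished_triangle_morphism _ _ htri hW biprod.inl biprod.inl
      (biprod.inl_map f (𝟙 Z)).symm
  have hψφ : IsIso (ψ ≫ φ) := by
    let m : Triangle.mk f g h ⟶ Triangle.mk f g h :=
      { hom₁ := 𝟙 _
        hom₂ := 𝟙 _
        hom₃ := ψ ≫ φ
        comm₁ := (Category.comp_id f).trans (Category.id_comp f).symm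
        comm₂ := by
          change g ≫ ψ ≫ φ = 𝟙 P₀ ≫ g
          rw [reassoc_of% hψ₂, hφ₂, biprod.inl_fst_assoc, Category.id_comp]
        comm₃ := by
          change h ≫ (𝟙 P₁)⟦(1 : ℤ)⟧' = (ψ ≫ φ) ≫ h
          rw [Category.assoc, ← hφ₃, ← reassoc_of% hψ₃, ← Functor.map_comp, biprod.inl_fst] }
    exact isIso₃_of_isIso₁₂ m htri htri inferInstance inferInstance
  have hsnd : H ≫ biprod.snd⟦(1 : ℤ)⟧' = 0 := by
    have h1 : H ≫ (biprod.map f (𝟙 Z))⟦(1 : ℤ)⟧' = 0 := comp_distTriang_mor_zero₃₁ _ hW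
    have h2 := h1 =≫ biprod.snd⟦(1 : ℤ)⟧'
    rw [Category.assoc, ← Functor.map_comp] at h2
    simpa using h2
  have hmono : Mono φ := Preadditive.mono_of_cancel_zero _ fun {A} x hx => by
    have hxH : x ≫ H = 0 := by
      have h1 : x ≫ H ≫ biprod.fst⟦(1 : ℤ)⟧' = 0 := by rw [hφ₃, reassoc_of% hx, zero_comp]
      rw [← Category.comp_id H, id_shift_biprod, Preadditive.comp_add, Preadditive.comp_add,
        reassoc_of% hsnd, reassoc_of% h1]
      simp
    obtain ⟨y, rfl⟩ : ∃ y : A ⟶ P₀ ⊞ Z, x = y ≫ G := Triangle.coyoneda_exact₃ _ hW x hxH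
    have hyg : (y ≫ biprod.fst) ≫ g = 0 := by
      rw [Category.assoc, ← hφ₂, ← Category.assoc, hx]
    obtain ⟨w, hw⟩ : ∃ w : A ⟶ P₁, y ≫ biprod.fst = w ≫ f :=
      Triangle.coyoneda_exact₂ _ htri (y ≫ biprod.fst) hyg
    have hFG : biprod.map f (𝟙 Z) ≫ G = 0 := comp_distTriang_mor_zero₁₂ _ hW
    have hy : y = biprod.lift w (y ≫ biprod.snd) ≫ biprod.map f (𝟙 Z) := by
      ext <;> simp [hw]
    rw [hy, Category.assoc, hFG, comp_zero]
  have hepi : IsSplitEpi φ := ⟨⟨⟨inv (ψ ≫ φ) ≫ ψ, by simp⟩⟩⟩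
  have : IsIso φ := isIso_of_mono_of_isSplitEpi φ
  exact ⟨W, (asIso φ).symm, G, H, hW⟩

variable [HasFiniteBiproducts C]

/-- Rigidity of `T` passes to all morphisms between objects of `add T`. -/
theorem IsRigid.eq_zero_of_inAdd_s6 {T P Q : C} (hT : IsRigid T) (hP : InAdd T P) (hQ : InAdd T Q)
    (φ : P ⟶ Q⟦(1 : ℤ)⟧) : φ = 0 := by
  obtain ⟨n, P', ⟨eP⟩⟩ := hP
  obtain ⟨m, Q', ⟨eQ⟩⟩ := hQ
  have key : ∀ θ : (⨁ fun _ : Fin n => T) ⟶ (⨁ fun _ : Fin m => T)⟦(1 : ℤ)⟧, θ = 0 := fun θ => by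
    refine biproduct.hom_ext' _ _ fun i => ?_
    have h1 : 𝟙 ((⨁ fun _ : Fin m => T)⟦(1 : ℤ)⟧) =
        ∑ j, (biproduct.π (fun _ : Fin m => T) j)⟦(1 : ℤ)⟧' ≫
          (biproduct.ι (fun _ : Fin m => T) j)⟦(1 : ℤ)⟧' := by
      simp only [← Functor.map_comp]
      rw [← Functor.map_sum, biproduct.total, CategoryTheory.Functor.map_id]
    rw [comp_zero, ← Category.comp_id θ, h1, Preadditive.comp_sum, Preadditive.comp_sum]
    refine Finset.sum_eq_zero fun j _ => ?_
    have h2 := hT (biproduct.ι (fun _ : Fin n => T) i ≫ θ ≫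
      (biproduct.π (fun _ : Fin m => T) j)⟦(1 : ℤ)⟧')
    rw [reassoc_of% h2, zero_comp]
  have h1 := (biprod.inl ≫ eP.hom) ≫=
    key (eP.inv ≫ biprod.fst ≫ φ ≫ (biprod.inl ≫ eQ.hom)⟦(1 : ℤ)⟧') =≫
      (eQ.inv ≫ biprod.fst)⟦(1 : ℤ)⟧'
  simpa [← Functor.map_comp] using h1

theorem IsRigid.eq_zero_of_inAdd_biprod {T P P' Q Q' : C} (hT : IsRigid T) (hP : InAdd T P)
    (hP' : InAdd T P') (hQ : InAdd T Q) (hQ' : InAdd T Q') (φ : P ⊞ P' ⟶ (Q ⊞ Q')⟦(1 : ℤ)⟧) :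
    φ = 0 := by
  have h : ∀ {A : C}, InAdd T A → ∀ ξ : A ⟶ (Q ⊞ Q')⟦(1 : ℤ)⟧, ξ = 0 := fun hA ξ => by
    rw [← Category.comp_id ξ, id_shift_biprod, Preadditive.comp_add, ← Category.assoc, ← Category.assoc,
      hT.eq_zero_of_inAdd_s6 hA hQ (ξ ≫ _), hT.eq_zero_of_inAdd_s6 hA hQ' (ξ ≫ _)]
    simp
  ext
  · rw [h hP (biprod.inl ≫ φ), comp_zero]
  · rw [h hP' (biprod.inr ≫ φ), comp_zero]

end Triangulated

theorem rigid_objects_same_index_isomorphic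
    (k : Type*) [Field k]
    (C : Type u) [Category.{v} C] [Preadditive C] [Linear k C] [HasZeroObject C]
    [HasShift C ℤ] [∀ n : ℤ, (shiftFunctor C n).Additive] [Pretriangulated C]
    [HasFiniteBiproducts C] [IsIdempotentComplete C]
    (hfd : ∀ X Y : C, FiniteDimensional k (X ⟶ Y))
    (cy : TwoCYStructure k C)
    (T : C) (hT : IsClusterTilting T)
    (X Y : C) (hX : IsRigid X) (hY : IsRigid Y)
    (T₁X T₀X : C) (fX : T₁X ⟶ T₀X) (gX : T₀X ⟶ X) (hX' : X ⟶ T₁X⟦(1 : ℤ)⟧)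
    (hT₀X : InAdd T T₀X) (hT₁X : InAdd T T₁X)
    (htriX : Triangle.mk fX gX hX' ∈ distTriang C)
    (T₁Y T₀Y : C) (fY : T₁Y ⟶ T₀Y) (gY : T₀Y ⟶ Y) (hY' : Y ⟶ T₁Y⟦(1 : ℤ)⟧)
    (hT₀Y : InAdd T T₀Y) (hT₁Y : InAdd T T₁Y)
    (htriY : Triangle.mk fY gY hY' ∈ distTriang C)
    (hindex : Nonempty ((T₀X ⊞ T₁Y) ≅ (T₀Y ⊞ T₁X))) :
    Nonempty (X ≅ Y) := by
  obtain ⟨i⟩ := hindex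
  obtain ⟨X', eX, gX₂, hX₂, htriX₂⟩ := exists_distinguished_biprod_map_id htriX T₁Y
  obtain ⟨Y', eY, gY₂, hY₂, htriY₂⟩ := exists_distinguished_biprod_map_id htriY T₁X
  let b : T₁X ⊞ T₁Y ≅ T₁Y ⊞ T₁X := biprod.braiding _ _
  have h₁ : (b.hom ≫ biprod.map fY (𝟙 T₁X) ≫ i.inv) ≫ i.hom =
      b.hom ≫ biprod.map fY (𝟙 T₁X) := by simp
  have h₂ : (hY₂ ≫ b.inv⟦(1 : ℤ)⟧') ≫ b.hom⟦(1 : ℤ)⟧' = 𝟙 Y' ≫ hY₂ := by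
    rw [Category.assoc, ← Functor.map_comp, b.inv_hom_id]
    simp
  have htriY₃ := isomorphic_distinguished _ htriY₂
    (Triangle.mk (b.hom ≫ biprod.map fY (𝟙 T₁X) ≫ i.inv) (i.hom ≫ gY₂) (hY₂ ≫ b.inv⟦(1 : ℤ)⟧'))
    (Triangle.isoMk _ _ b i (Iso.refl Y') h₁ (Category.comp_id _) h₂)
  obtain ⟨e⟩ := (hX.of_iso eX).nonempty_iso_of_presentations k hfd (hY.of_iso eY) htriX₂ htriY₃
    (hT.1.eq_zero_of_inAdd_biprod hT₀X hT₁Y hT₁X hT₁Y)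
  exact ⟨eX ≪≫ e ≪≫ eY.symm⟩
end

section
/- Let C be as in the 2-Calabi–Yau setup and T a cluster-tilting object of C. Let X → Y → Z →ᶠ ΣX be a distinguished triangle whose connecting morphism f: Z → ΣX factors through an object of add(ΣT). Given add T-presentation triangles T₁^X → T₀^X → X → ΣT₁^X, T₁^Y → T₀^Y → Y → ΣT₁^Y, and T₁^Z → T₀^Z → Z → ΣT₁^Z (all outer terms in add T), one has T₀^Y ⊕ T₁^X ⊕ T₁^Z ≅ T₁^Y ⊕ T₀^X ⊕ T₀^Z. (Equivalently, ind_T Y = ind_T X + ind_T Z.) -/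
/-!
STATEMENT 7 (Palu): In the 2-Calabi–Yau setup, let `T` be a cluster-tilting object
and `X → Y → Z →ᶠ ΣX` a distinguished triangle whose connecting morphism `f` factors
through an object of `add (ΣT)`.  Then, for chosen `add T`-presentation triangles of
`X`, `Y`, `Z`, one has `T₀^Y ⊞ T₁^X ⊞ T₁^Z ≅ T₁^Y ⊞ T₀^X ⊞ T₀^Z`
(equivalently, `ind_T Y = ind_T X + ind_T Z`).

Krull–Schmidt is encoded as idempotent completeness, which, together with
Hom-finiteness over the field `k`, is equivalent to the Krull–Schmidt property.
-/
open CategoryTheory Limits Pretriangulated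

universe v u

theorem isLocalRing_of_forall_isIdempotentElem (k : Type*) {A : Type*} [Field k] [Ring A]
    [Algebra k A] [FiniteDimensional k A] [Nontrivial A]
    (h : ∀ e : A, IsIdempotentElem e → e = 0 ∨ e = 1) : IsLocalRing A := by
  refine IsLocalRing.of_isUnit_or_isUnit_one_sub_self fun x => ?_
  have hp : minpoly k x ≠ 0 := minpoly.ne_zero (IsIntegral.of_finite k x)
  obtain ⟨g, hg, hXg⟩ := Polynomial.exists_eq_pow_rootMultiplicity_mul_and_not_dvd _ hp 0
  set n := (minpoly k x).rootMultiplicity 0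
  rw [Polynomial.C_0, sub_zero] at hg hXg
  have hcop : IsCoprime (Polynomial.X ^ (n + 1)) g :=
    ((Polynomial.prime_X.irreducible.coprime_iff_not_dvd).2 hXg).pow_left
  obtain ⟨a, b, hab⟩ := hcop
  have hzero : x ^ n * Polynomial.aeval x g = 0 := by
    have := congr(Polynomial.aeval x $hg).symm
    rwa [minpoly.aeval, map_mul, map_pow, Polynomial.aeval_X] at this
  have hone : Polynomial.aeval x a * x ^ (n + 1) +
      Polynomial.aeval x b * Polynomial.aeval x g = 1 := by
    simpa using congr(Polynomial.aeval x $hab)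
  have hidem : IsIdempotentElem (Polynomial.aeval x (a * Polynomial.X ^ (n + 1))) := by
    have hmul : a * Polynomial.X ^ (n + 1) * (a * Polynomial.X ^ (n + 1)) =
        a * Polynomial.X ^ (n + 1) - a * b * Polynomial.X * minpoly k x := by
      rw [hg]
      linear_combination (a * Polynomial.X ^ (n + 1)) * hab
    rw [IsIdempotentElem, ← map_mul, hmul]
    simp
  rcases h _ hidem with h0 | h1
  · right
    apply IsNilpotent.isUnit_one_sub
    refine ⟨n, ?_⟩
    rw [map_mul, map_pow, Polynomial.aeval_X] at h0
    rw [h0, zero_add] at hone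
    have hcomm : Polynomial.aeval x b * Polynomial.aeval x g =
        Polynomial.aeval x g * Polynomial.aeval x b := by
      rw [← map_mul, mul_comm, map_mul]
    rw [← mul_one (x ^ n), ← hone, hcomm, ← mul_assoc, hzero, zero_mul]
  · left
    refine isUnit_iff_exists.2 ⟨Polynomial.aeval x (a * Polynomial.X ^ n), ?_, ?_⟩
    · rw [← h1, pow_succ', mul_left_comm, map_mul _ Polynomial.X, Polynomial.aeval_X]
    · rw [← h1, pow_succ, ← mul_assoc, map_mul _ _ Polynomial.X, Polynomial.aeval_X]

section FiniteSums

variable {C : Type u} [Category.{v} C] [Preadditive C]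

/-- The identity of `X` is a finite sum of morphisms factoring through `T`. -/
def IsSumRetract (T X : C) : Prop :=
  ∃ (ι : Type) (_ : Fintype ι) (i : ι → (X ⟶ T)) (p : ι → (T ⟶ X)), ∑ j, i j ≫ p j = 𝟙 X

namespace IsSumRetract

variable {T X Y : C}

theorem refl (T : C) : IsSumRetract T T :=
  ⟨Unit, inferInstance, fun _ => 𝟙 T, fun _ => 𝟙 T, by simp⟩

theorem of_retract (hX : IsSumRetract T X) (r : Retract Y X) : IsSumRetract T Y := by
  obtain ⟨ι, _, i, p, h⟩ := hX
  refine ⟨ι, inferInstance, fun j => r.i ≫ i j, fun j => p j ≫ r.r, ?_⟩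
  have := congr(r.i ≫ $h ≫ r.r)
  simpa [Preadditive.comp_sum, Preadditive.sum_comp] using this

theorem biprod [HasBinaryBiproducts C] (hX : IsSumRetract T X) (hY : IsSumRetract T Y) :
    IsSumRetract T (X ⊞ Y) := by
  obtain ⟨ι, _, i, p, h⟩ := hX
  obtain ⟨ι', _, i', p', h'⟩ := hY
  refine ⟨ι ⊕ ι', inferInstance, Sum.elim (fun j => biprod.fst ≫ i j) (fun j => biprod.snd ≫ i' j),
    Sum.elim (fun j => p j ≫ biprod.inl) (fun j => p' j ≫ biprod.inr), ?_⟩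
  rw [Fintype.sum_sum_type, ← biprod.total]
  congr 1
  · simpa [Preadditive.comp_sum, Preadditive.sum_comp] using
      congr((biprod.fst : X ⊞ Y ⟶ X) ≫ $h ≫ (biprod.inl : X ⟶ X ⊞ Y))
  · simpa [Preadditive.comp_sum, Preadditive.sum_comp] using
      congr((biprod.snd : X ⊞ Y ⟶ Y) ≫ $h' ≫ (biprod.inr : Y ⟶ X ⊞ Y))

theorem biproduct [HasFiniteBiproducts C] (n : ℕ) :
    IsSumRetract T (⨁ (fun _ : Fin n => T)) :=
  ⟨Fin n, inferInstance, biproduct.π _, biproduct.ι _, biproduct.total⟩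

theorem hom_ext (hX : IsSumRetract T X) {f g : X ⟶ Y} (h : ∀ t : T ⟶ X, t ≫ f = t ≫ g) :
    f = g := by
  obtain ⟨ι, _, i, p, hip⟩ := hX
  rw [← Category.id_comp f, ← Category.id_comp g, ← hip, Preadditive.sum_comp,
    Preadditive.sum_comp]
  exact Finset.sum_congr rfl fun j _ => by rw [Category.assoc, h, Category.assoc]

theorem exists_lift (hX : IsSumRetract T X) {E P : C} (e : E ⟶ P) (f : X ⟶ P)
    (h : ∀ t : T ⟶ X, ∃ s : T ⟶ E, t ≫ f = s ≫ e) : ∃ s : X ⟶ E, f = s ≫ e := by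
  obtain ⟨ι, _, i, p, hip⟩ := hX
  choose s hs using fun j => h (p j)
  refine ⟨∑ j, i j ≫ s j, ?_⟩
  rw [← Category.id_comp f, ← hip, Preadditive.sum_comp, Preadditive.sum_comp]
  exact Finset.sum_congr rfl fun j _ => by rw [Category.assoc, hs, Category.assoc]

theorem map {D : Type*} [Category* D] [Preadditive D] (F : C ⥤ D) [F.Additive]
    (hX : IsSumRetract T X) : IsSumRetract (F.obj T) (F.obj X) := by
  obtain ⟨ι, _, i, p, h⟩ := hX
  refine ⟨ι, inferInstance, fun j => F.map (i j), fun j => F.map (p j), ?_⟩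
  simp only [← F.map_comp, ← F.map_sum, h, F.map_id]

theorem eq_zero_of_forall {W : C} (hX : IsSumRetract T X) (h : ∀ f : W ⟶ T, f = 0)
    (f : W ⟶ X) : f = 0 := by
  obtain ⟨ι, _, i, p, hip⟩ := hX
  rw [← Category.comp_id f, ← hip, Preadditive.comp_sum]
  exact Finset.sum_eq_zero fun j _ => by rw [← Category.assoc, h (f ≫ i j), zero_comp]

theorem eq_zero_of_forall' {W : C} (hX : IsSumRetract T X) (h : ∀ f : T ⟶ W, f = 0)
    (f : X ⟶ W) : f = 0 :=
  hX.hom_ext fun t => by rw [h (t ≫ f), comp_zero]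

end IsSumRetract

/-- A summand has a complement in an idempotent complete preadditive category. -/
theorem exists_iso_biprod_of_retract [HasBinaryBiproducts C] [IsIdempotentComplete C] {P A : C}
    (r : Retract P A) : ∃ A' : C, Nonempty (A ≅ P ⊞ A') := by
  obtain ⟨A', j, q, hjq, hqj⟩ := IsIdempotentComplete.idempotents_split A (𝟙 A - r.r ≫ r.i)
    (by simp)
  have hi : r.i ≫ q = 0 := by
    rw [← Category.comp_id q, ← hjq, ← Category.assoc q, hqj]
    simp
  have hr : j ≫ r.r = 0 := by
    rw [← Category.id_comp j, ← hjq, Category.assoc, Category.assoc, ← Category.assoc q, hqj]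
    simp
  refine ⟨A', ⟨⟨biprod.lift r.r q, biprod.desc r.i j, ?_, ?_⟩⟩⟩
  · simp [biprod.lift_desc, hqj]
  · ext <;> simp [hi, hr, hjq]

end FiniteSums

section Dimension

variable {k : Type*} [Field k] {C : Type u} [Category.{v} C] [Preadditive C] [Linear k C]

theorem finrank_hom_biprod [HasBinaryBiproducts C] (hfd : ∀ X Y : C, FiniteDimensional k (X ⟶ Y))
    (A B M : C) : Module.finrank k (A ⊞ B ⟶ M) =
      Module.finrank k (A ⟶ M) + Module.finrank k (B ⟶ M) := by
  have e : (A ⊞ B ⟶ M) ≃ₗ[k] (A ⟶ M) × (B ⟶ M) :=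
    LinearEquiv.ofBijective
      ((Linear.leftComp k M (biprod.inl : A ⟶ A ⊞ B)).prod
        (Linear.leftComp k M (biprod.inr : B ⟶ A ⊞ B)))
      ⟨fun f g h => by
        have h' := Prod.ext_iff.1 h
        exact biprod.hom_ext' _ _ h'.1 h'.2,
       fun p => ⟨biprod.desc p.1 p.2, by simp⟩⟩
  have := hfd A M
  have := hfd B M
  rw [e.finrank_eq, Module.finrank_prod]

theorem finrank_hom_congr {A B : C} (e : A ≅ B) (M : C) :
    Module.finrank k (A ⟶ M) = Module.finrank k (B ⟶ M) :=
  (Linear.homCongr k e (Iso.refl M)).finrank_eq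

/-- A nonzero summand of `A` with endomorphism ring of minimal dimension has a local endomorphism
ring. -/
theorem exists_retract_isLocalRing_end [IsIdempotentComplete C]
    (hfd : ∀ X Y : C, FiniteDimensional k (X ⟶ Y)) (A : C) (hA : 𝟙 A ≠ 0) :
    ∃ P : C, Nonempty (Retract P A) ∧ IsLocalRing (End P) := by
  classical
  have hex : ∃ (n : ℕ) (P : C), Nonempty (Retract P A) ∧ 𝟙 P ≠ 0 ∧
      Module.finrank k (P ⟶ P) = n := ⟨_, A, ⟨Retract.refl A⟩, hA, rfl⟩
  obtain ⟨P, ⟨r⟩, hP, hn⟩ := Nat.find_spec hex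
  have hmin : ∀ Q : C, Nonempty (Retract Q P) → 𝟙 Q ≠ 0 →
      Module.finrank k (P ⟶ P) ≤ Module.finrank k (Q ⟶ Q) := fun Q ⟨s⟩ hQ => by
    rw [hn]
    exact Nat.find_min' hex ⟨Q, ⟨s.trans r⟩, hQ, rfl⟩
  refine ⟨P, ⟨r⟩, ?_⟩
  have : FiniteDimensional k (End P) := hfd P P
  have : Nontrivial (End P) := ⟨⟨𝟙 P, 0, hP⟩⟩
  refine isLocalRing_of_forall_isIdempotentElem k fun e he => ?_
  obtain ⟨Q, j, q, hjq, hqj⟩ := IsIdempotentComplete.idempotents_split P e he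
  by_cases hQ : 𝟙 Q = 0
  · left
    rw [← hqj, ← Category.comp_id q, hQ]
    simp
  · right
    have hQP := hmin Q ⟨⟨j, q, hjq⟩⟩ hQ
    have := hfd P P
    have := hfd Q Q
    let φ : (Q ⟶ Q) →ₗ[k] (P ⟶ P) := (Linear.leftComp k P q).comp (Linear.rightComp k Q j)
    have hφ : Function.Injective φ := fun x y hxy => by
      have hxy' : q ≫ x ≫ j = q ≫ y ≫ j := hxy
      have := congr(j ≫ $hxy' ≫ q)
      simpa [hjq, reassoc_of% hjq] using this
    obtain ⟨x, hx⟩ := (LinearMap.injective_iff_surjective_of_finrank_eq_finrank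
      (le_antisymm (LinearMap.finrank_le_finrank_of_injective hφ) hQP)).1 hφ (𝟙 P)
    have hx' : q ≫ x ≫ j = 𝟙 P := hx
    change (e : P ⟶ P) = 𝟙 P
    calc (e : P ⟶ P) = (q ≫ x ≫ j) ≫ q ≫ j := by rw [hx', Category.id_comp, hqj]
      _ = 𝟙 P := by rw [← hx']; simp [reassoc_of% hjq]

end Dimension

section Triangulated

variable {C : Type u} [Category.{v} C] [Preadditive C] [HasZeroObject C]
  [HasShift C ℤ] [∀ n : ℤ, (shiftFunctor C n).Additive] [Pretriangulated C]

theorem InAdd.isSumRetract [HasFiniteBiproducts C] {T X : C} (h : InAdd T X) :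
    IsSumRetract T X := by
  obtain ⟨n, Y, ⟨e⟩⟩ := h
  exact (IsSumRetract.biproduct n).of_retract
    ⟨biprod.inl ≫ e.hom, e.inv ≫ biprod.fst, by simp⟩

omit [HasZeroObject C] [Pretriangulated C] in
theorem IsRigid.eq_zero [HasFiniteBiproducts C] {T : C} (hT : IsRigid T) {A B : C}
    (hA : IsSumRetract T A) (hB : IsSumRetract T B) (f : A ⟶ B⟦(1 : ℤ)⟧) : f = 0 :=
  hA.eq_zero_of_forall' ((hB.map (shiftFunctor C (1 : ℤ))).eq_zero_of_forall hT) f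

/-- `Hom(-, W)` is exact at the first object of a distinguished triangle. -/
theorem exists_extension_of_comp_shift_eq_zero {X Y Z : C} {u : X ⟶ Y} {v : Y ⟶ Z}
    {f : Z ⟶ X⟦(1 : ℤ)⟧} (h : Triangle.mk u v f ∈ distTriang C) {W : C} (g : X ⟶ W)
    (hg : f ≫ g⟦(1 : ℤ)⟧' = 0) : ∃ g' : Y ⟶ W, g = u ≫ g' := by
  obtain ⟨q, hq⟩ : ∃ q : Y⟦(1 : ℤ)⟧ ⟶ W⟦(1 : ℤ)⟧, g⟦(1 : ℤ)⟧' = (-u⟦(1 : ℤ)⟧') ≫ q :=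
    Triangle.yoneda_exact₃ _ (rot_of_distTriang _ h) (g⟦(1 : ℤ)⟧') hg
  obtain ⟨p, rfl⟩ := (shiftFunctor C (1 : ℤ)).map_surjective q
  exact ⟨-p, (shiftFunctor C (1 : ℤ)).map_injective (by simp [hq])⟩

section Linear

variable {k : Type*} [Field k] [Linear k C]

omit [HasZeroObject C] [∀ n : ℤ, (shiftFunctor C n).Additive] [Pretriangulated C] in
theorem TwoCYStructure.shiftFunctor_linear (cy : TwoCYStructure k C) :
    (shiftFunctor C (1 : ℤ)).Linear k where
  map_smul {X Y} f r := by
    have key : cy.pair (X⟦(1 : ℤ)⟧) Y (𝟙 _ ≫ (r • f)⟦(1 : ℤ)⟧') =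
        cy.pair (X⟦(1 : ℤ)⟧) Y (𝟙 _ ≫ (r • f⟦(1 : ℤ)⟧')) := by
      ext β
      rw [cy.nat_right, Linear.comp_smul, map_smul, LinearMap.smul_apply, cy.nat_right,
        Linear.smul_comp, map_smul]
    simpa using (cy.bijective _ _).1 key

variable (k) in
/-- The dimension of the space of morphisms to `M` vanishing after precomposition with `g`. -/
noncomputable def finrankKerPrecomp {Y Z : C} (g : Y ⟶ Z) (M : C) : ℕ :=
  Module.finrank k (LinearMap.ker (Linear.leftComp k M g))

variable (hfd : ∀ X Y : C, FiniteDimensional k (X ⟶ Y))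

include hfd in
theorem finrank_hom_triangle [(shiftFunctor C (1 : ℤ)).Linear k]
    {X Y Z : C} {u : X ⟶ Y} {v : Y ⟶ Z}
    {f : Z ⟶ X⟦(1 : ℤ)⟧} (h : Triangle.mk u v f ∈ distTriang C) (M : C) :
    Module.finrank k (X ⟶ M) + Module.finrank k (Z ⟶ M) = Module.finrank k (Y ⟶ M) +
      finrankKerPrecomp k v M + finrankKerPrecomp k v (M⟦(1 : ℤ)⟧) := by
  let vM := Linear.leftComp k M v
  let uM := Linear.leftComp k M u
  let d : (X ⟶ M) →ₗ[k] (Z ⟶ M⟦(1 : ℤ)⟧) :=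
    (Linear.leftComp k _ f).comp ((shiftFunctor C (1 : ℤ)).mapLinearMap k)
  have huv : u ≫ v = 0 := comp_distTriang_mor_zero₁₂ _ h
  have hvf : v ≫ f = 0 := comp_distTriang_mor_zero₂₃ _ h
  have hfu : f ≫ u⟦(1 : ℤ)⟧' = 0 := comp_distTriang_mor_zero₃₁ _ h
  have h1 : LinearMap.ker uM = LinearMap.range vM := by
    ext g
    constructor
    · intro hg
      obtain ⟨g', rfl⟩ := Triangle.yoneda_exact₂ _ h g hg
      exact ⟨g', rfl⟩
    · rintro ⟨g', rfl⟩
      change u ≫ v ≫ g' = 0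
      rw [reassoc_of% huv, zero_comp]
  have h2 : LinearMap.ker d = LinearMap.range uM := by
    ext g
    constructor
    · intro hg
      obtain ⟨g', rfl⟩ := exists_extension_of_comp_shift_eq_zero h g hg
      exact ⟨g', rfl⟩
    · rintro ⟨g', rfl⟩
      change f ≫ (u ≫ g')⟦(1 : ℤ)⟧' = 0
      rw [Functor.map_comp, reassoc_of% hfu, zero_comp]
  have h3 : LinearMap.range d = LinearMap.ker (Linear.leftComp k (M⟦(1 : ℤ)⟧) v) := by
    ext g
    constructor
    · rintro ⟨g', rfl⟩
      change v ≫ f ≫ g'⟦(1 : ℤ)⟧' = 0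
      rw [reassoc_of% hvf, zero_comp]
    · intro hg
      obtain ⟨g', rfl⟩ := Triangle.yoneda_exact₃ _ h g hg
      obtain ⟨p, rfl⟩ := (shiftFunctor C (1 : ℤ)).map_surjective g'
      exact ⟨p, rfl⟩
  have := hfd X M
  have := hfd Y M
  have := hfd Z M
  have r1 := LinearMap.finrank_range_add_finrank_ker vM
  have r2 := LinearMap.finrank_range_add_finrank_ker uM
  have r3 := LinearMap.finrank_range_add_finrank_ker d
  rw [h1] at r2
  rw [h2, h3] at r3
  change _ = _ + Module.finrank k (LinearMap.ker vM) + Module.finrank k (LinearMap.ker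
    (Linear.leftComp k (M⟦(1 : ℤ)⟧) v))
  lia

variable [HasFiniteBiproducts C]

include hfd in
theorem finrankKerPrecomp_add {T : C} (hT : IsRigid T)
    {X Y Z : C} {u : X ⟶ Y} {v : Y ⟶ Z} {f : Z ⟶ X⟦(1 : ℤ)⟧}
    (htri : Triangle.mk u v f ∈ distTriang C)
    {M : C} {a : Z ⟶ M} {b : M ⟶ X⟦(1 : ℤ)⟧} (hM : IsSumRetract (T⟦(1 : ℤ)⟧) M) (hf : f = a ≫ b)
    {T₁X T₀X : C} {fX : T₁X ⟶ T₀X} {gX : T₀X ⟶ X} {hX : X ⟶ T₁X⟦(1 : ℤ)⟧}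
    (hT₀X : IsSumRetract T T₀X) (hT₁X : IsSumRetract T T₁X)
    (htriX : Triangle.mk fX gX hX ∈ distTriang C)
    {T₁Y T₀Y : C} {fY : T₁Y ⟶ T₀Y} {gY : T₀Y ⟶ Y} {hY : Y ⟶ T₁Y⟦(1 : ℤ)⟧}
    (hT₀Y : IsSumRetract T T₀Y) (hT₁Y : IsSumRetract T T₁Y)
    (htriY : Triangle.mk fY gY hY ∈ distTriang C)
    {T₁Z T₀Z : C} {fZ : T₁Z ⟶ T₀Z} {gZ : T₀Z ⟶ Z} {hZ : Z ⟶ T₁Z⟦(1 : ℤ)⟧}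
    (hT₀Z : IsSumRetract T T₀Z) (hT₁Z : IsSumRetract T T₁Z)
    (htriZ : Triangle.mk fZ gZ hZ ∈ distTriang C) (N : C) :
    finrankKerPrecomp k gY N + finrankKerPrecomp k v N =
      finrankKerPrecomp k gX N + finrankKerPrecomp k gZ N := by
  have huv : u ≫ v = 0 := comp_distTriang_mor_zero₁₂ _ htri
  -- maps from `add T` lift along the approximations
  obtain ⟨sX, hsX⟩ : ∃ sX : T₀X ⟶ T₀Y, gX ≫ u = sX ≫ gY :=
    Triangle.coyoneda_exact₃ _ htriY (gX ≫ u) (hT.eq_zero hT₀X hT₁Y _)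
  obtain ⟨sY, hsY⟩ : ∃ sY : T₀Y ⟶ T₀Z, gY ≫ v = sY ≫ gZ :=
    Triangle.coyoneda_exact₃ _ htriZ (gY ≫ v) (hT.eq_zero hT₀Y hT₁Z _)
  have hb : b ≫ hX⟦(1 : ℤ)⟧' = 0 := hM.eq_zero_of_forall' (fun t => by
    obtain ⟨s, rfl⟩ := (shiftFunctor C (1 : ℤ)).map_surjective t
    rw [hT.eq_zero (.refl T) hT₁X s, Functor.map_zero]) _
  obtain ⟨r, hr⟩ := exists_extension_of_comp_shift_eq_zero htri hX (by
    rw [hf, Category.assoc, hb, comp_zero])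
  have hgZf : gZ ≫ f = 0 := by
    rw [hf, ← Category.assoc, hM.eq_zero_of_forall (hT₀Z.eq_zero_of_forall' hT) (gZ ≫ a), zero_comp]
  obtain ⟨l, hl⟩ : ∃ l : T₀Z ⟶ Y, gZ = l ≫ v :=
    Triangle.coyoneda_exact₃ _ htri gZ hgZf
  obtain ⟨sZ, hsZ⟩ : ∃ sZ : T₀Z ⟶ T₀Y, l = sZ ≫ gY :=
    Triangle.coyoneda_exact₃ _ htriY l (hT.eq_zero hT₀Z hT₁Y _)
  have hgYr : gY ≫ r = 0 := hT.eq_zero hT₀Y hT₁X _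
  let vN := Linear.leftComp k N v
  let uN := Linear.leftComp k N u
  let KX := LinearMap.ker (Linear.leftComp k N gX)
  let KY := LinearMap.ker (Linear.leftComp k N gY)
  let KZ := LinearMap.ker (Linear.leftComp k N gZ)
  have h1 : LinearMap.range (uN.domRestrict KY) = KX := by
    ext g
    constructor
    · rintro ⟨⟨g', hg'⟩, rfl⟩
      change gY ≫ g' = 0 at hg'
      change gX ≫ u ≫ g' = 0
      rw [← Category.assoc, hsX, Category.assoc, hg', comp_zero]
    · intro hg
      obtain ⟨d, rfl⟩ : ∃ d : T₁X⟦(1 : ℤ)⟧ ⟶ N, g = hX ≫ d :=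
        Triangle.yoneda_exact₃ _ htriX g hg
      refine ⟨⟨r ≫ d, ?_⟩, ?_⟩
      · change gY ≫ r ≫ d = 0
        rw [reassoc_of% hgYr, zero_comp]
      · change u ≫ r ≫ d = hX ≫ d
        rw [hr, Category.assoc]
  have h2 : (LinearMap.ker (uN.domRestrict KY)).map KY.subtype =
      LinearMap.range (vN.domRestrict KZ) := by
    ext g
    constructor
    · rintro ⟨⟨g', hg'⟩, hu, rfl⟩
      change gY ≫ g' = 0 at hg'
      obtain ⟨h', rfl⟩ : ∃ h' : Z ⟶ N, g' = v ≫ h' := Triangle.yoneda_exact₂ _ htri g' hu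
      refine ⟨⟨h', ?_⟩, rfl⟩
      change gZ ≫ h' = 0
      rw [hl, Category.assoc, hsZ, Category.assoc, hg', comp_zero]
    · rintro ⟨⟨g', hg'⟩, rfl⟩
      change gZ ≫ g' = 0 at hg'
      refine ⟨⟨v ≫ g', ?_⟩, ?_, rfl⟩
      · change gY ≫ v ≫ g' = 0
        rw [← Category.assoc, hsY, Category.assoc, hg', comp_zero]
      · change u ≫ v ≫ g' = 0
        rw [reassoc_of% huv, zero_comp]
  have h3 : (LinearMap.ker (vN.domRestrict KZ)).map KZ.subtype = LinearMap.ker vN := by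
    ext g
    constructor
    · rintro ⟨g', hg', rfl⟩
      exact hg'
    · intro hg
      obtain ⟨g', rfl⟩ : ∃ g' : X⟦(1 : ℤ)⟧ ⟶ N, g = f ≫ g' :=
        Triangle.yoneda_exact₃ _ htri g hg
      refine ⟨⟨f ≫ g', ?_⟩, hg, rfl⟩
      change gZ ≫ f ≫ g' = 0
      rw [reassoc_of% hgZf, zero_comp]
  have := hfd Y N
  have := hfd Z N
  have r1 := LinearMap.finrank_range_add_finrank_ker (uN.domRestrict KY)
  have r2 := LinearMap.finrank_range_add_finrank_ker (vN.domRestrict KZ)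
  rw [h1, ← Submodule.finrank_map_subtype_eq, h2] at r1
  rw [← Submodule.finrank_map_subtype_eq KZ (LinearMap.ker _), h3] at r2
  change Module.finrank k KY + Module.finrank k (LinearMap.ker vN) =
    Module.finrank k KX + Module.finrank k KZ
  lia

include hfd in
/-- Objects of `add T`, for `T` rigid, are determined by the dimensions of their spaces of
morphisms to all objects. -/
theorem nonempty_iso_of_finrank_hom_eq [IsIdempotentComplete C] {T : C} (hT : IsRigid T) {A B : C}
    (hA : IsSumRetract T A) (hB : IsSumRetract T B)
    (hAB : ∀ M : C, Module.finrank k (A ⟶ M) = Module.finrank k (B ⟶ M)) : Nonempty (A ≅ B) := by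
  induction hn : Module.finrank k (A ⟶ T) using Nat.strong_induction_on generalizing A B with
  | _ n ih =>
  by_cases hA0 : 𝟙 A = 0
  · have hB0 : 𝟙 B = 0 := by
      have := hfd B B
      have : Subsingleton (A ⟶ B) := ⟨fun f g => by
        rw [← Category.id_comp f, ← Category.id_comp g, hA0, zero_comp, zero_comp]⟩
      have hfin := hAB B
      rw [Module.finrank_zero_of_subsingleton] at hfin
      have := Module.finrank_zero_iff.1 hfin.symm
      exact Subsingleton.elim _ _
    exact ⟨⟨0, 0, by rw [hA0, zero_comp], by rw [hB0, zero_comp]⟩⟩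
  obtain ⟨P, ⟨r⟩, hloc⟩ := exists_retract_isLocalRing_end hfd A hA0
  have hP := hA.of_retract r
  -- it suffices that `P` is also a summand of `B`
  suffices hPB : Nonempty (Retract P B) by
    obtain ⟨s⟩ := hPB
    obtain ⟨A', ⟨eA⟩⟩ := exists_iso_biprod_of_retract r
    obtain ⟨B', ⟨eB⟩⟩ := exists_iso_biprod_of_retract s
    have hdimA := fun M => (finrank_hom_congr (k := k) eA M).trans (finrank_hom_biprod hfd P A' M)
    have hdimB := fun M => (finrank_hom_congr (k := k) eB M).trans (finrank_hom_biprod hfd P B' M)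
    have hpos : 0 < Module.finrank k (P ⟶ T) := by
      have := hfd P T
      rw [Nat.pos_iff_ne_zero]
      intro h0
      have hsub := Module.finrank_zero_iff.1 h0
      exact hloc.toNontrivial.exists_pair_ne.elim fun x ⟨y, hxy⟩ => hxy
        ((hP.eq_zero_of_forall (fun f => Subsingleton.elim _ _) x).trans
        (hP.eq_zero_of_forall (fun f => Subsingleton.elim _ _) y).symm)
    obtain ⟨e⟩ := ih (Module.finrank k (A' ⟶ T)) (by rw [← hn, hdimA]; lia)
      (hA.of_retract ⟨biprod.inr ≫ eA.inv, eA.hom ≫ biprod.snd, by simp⟩)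
      (hB.of_retract ⟨biprod.inr ≫ eB.inv, eB.hom ≫ biprod.snd, by simp⟩)
      (fun M => by have := hAB M; rw [hdimA, hdimB] at this; lia) rfl
    exact ⟨eA ≪≫ biprod.mapIso (Iso.refl P) e ≪≫ eB.symm⟩
  have := hfd T P
  -- `p : P ⟶ N` detects the split epimorphisms among morphisms `T ⟶ P`
  obtain ⟨S, hS, hspan⟩ := (Submodule.fg_span_iff_fg_span_finset_subset (R := k)
    {t : T ⟶ P | ¬ ∃ c : P ⟶ T, c ≫ t = 𝟙 P}).1 (IsNoetherian.noetherian _)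
  let e : (⨁ fun _ : Fin S.card => T) ⟶ P := biproduct.desc fun j => (S.equivFin.symm j).1
  have he : ¬ ∃ s, 𝟙 P = s ≫ e := by
    rintro ⟨s, hs⟩
    let x (j : Fin S.card) : End P := s ≫ biproduct.π _ j ≫ (S.equivFin.symm j).1
    have hsum : ∑ j, x j = 1 := by
      change _ = 𝟙 P
      simp only [hs, e, biproduct.desc_eq, Preadditive.comp_sum]
      rfl
    obtain ⟨j, -, hj⟩ := IsLocalRing.exists_of_isUnit_sum (hsum ▸ isUnit_one)
    obtain ⟨y, hy⟩ := hj.exists_right_inv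
    refine hS (S.equivFin.symm j).2 ⟨y ≫ s ≫ biproduct.π _ j, ?_⟩
    simpa [x, End.mul_def] using hy
  have hlift (t : T ⟶ P) (ht : ¬ ∃ c : P ⟶ T, c ≫ t = 𝟙 P) : ∃ s, t = s ≫ e := by
    have hle : Submodule.span k (S : Set (T ⟶ P)) ≤ LinearMap.range (Linear.rightComp k T e) := by
      rw [Submodule.span_le]
      intro t ht
      refine ⟨biproduct.ι (fun _ : Fin S.card => T) (S.equivFin ⟨t, ht⟩), ?_⟩
      simp [e]
    obtain ⟨s, hs⟩ := hle (hspan ▸ Submodule.subset_span ht)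
    exact ⟨s, hs.symm⟩
  obtain ⟨N, p, q, hN⟩ := distinguished_cocone_triangle e
  have hAN : Module.finrank k (A ⟶ N) ≠ 0 := fun h0 => by
    have := hfd A N
    have := Module.finrank_zero_iff.1 h0
    obtain ⟨s, hs⟩ : ∃ s, r.r = s ≫ e :=
      Triangle.coyoneda_exact₂ _ hN r.r (Subsingleton.elim (r.r ≫ p) 0)
    exact he ⟨r.i ≫ s, by rw [Category.assoc, ← hs, r.retract]⟩
  have hBN : ∃ g : B ⟶ N, g ≠ 0 := by
    by_contra! h
    have : Subsingleton (B ⟶ N) := ⟨fun x y => by rw [h x, h y]⟩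
    exact hAN (by rw [hAB, Module.finrank_zero_of_subsingleton])
  obtain ⟨g, hg⟩ := hBN
  obtain ⟨b, hb⟩ : ∃ b : B ⟶ P, g = b ≫ p :=
    Triangle.coyoneda_exact₃ _ hN g (hT.eq_zero hB (.biproduct _) _)
  by_contra hPB
  obtain ⟨s, hs⟩ := hB.exists_lift e b fun t => hlift (t ≫ b) fun ⟨c, hc⟩ =>
    hPB ⟨⟨c ≫ t, b, by rw [Category.assoc, hc]⟩⟩
  have hep : e ≫ p = 0 := comp_distTriang_mor_zero₁₂ _ hN
  exact hg (by rw [hb, hs, Category.assoc, hep, comp_zero])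

end Linear

end Triangulated

theorem index_additive_on_triangles_over_shiftT
    (k : Type*) [Field k]
    (C : Type u) [Category.{v} C] [Preadditive C] [Linear k C] [HasZeroObject C]
    [HasShift C ℤ] [∀ n : ℤ, (shiftFunctor C n).Additive] [Pretriangulated C]
    [HasFiniteBiproducts C] [IsIdempotentComplete C]
    (hfd : ∀ X Y : C, FiniteDimensional k (X ⟶ Y))
    (cy : TwoCYStructure k C)
    (T : C) (hT : IsClusterTilting T)
    (X Y Z : C) (u : X ⟶ Y) (v : Y ⟶ Z) (f : Z ⟶ X⟦(1 : ℤ)⟧)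
    (htri : Triangle.mk u v f ∈ distTriang C)
    -- `f` factors through an object of `add (ΣT)`
    (hf : ∃ (M : C) (a : Z ⟶ M) (b : M ⟶ X⟦(1 : ℤ)⟧),
      InAdd (T⟦(1 : ℤ)⟧) M ∧ f = a ≫ b)
    (T₁X T₀X : C) (fX : T₁X ⟶ T₀X) (gX : T₀X ⟶ X) (hX : X ⟶ T₁X⟦(1 : ℤ)⟧)
    (hT₀X : InAdd T T₀X) (hT₁X : InAdd T T₁X)
    (htriX : Triangle.mk fX gX hX ∈ distTriang C)
    (T₁Y T₀Y : C) (fY : T₁Y ⟶ T₀Y) (gY : T₀Y ⟶ Y) (hY : Y ⟶ T₁Y⟦(1 : ℤ)⟧)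
    (hT₀Y : InAdd T T₀Y) (hT₁Y : InAdd T T₁Y)
    (htriY : Triangle.mk fY gY hY ∈ distTriang C)
    (T₁Z T₀Z : C) (fZ : T₁Z ⟶ T₀Z) (gZ : T₀Z ⟶ Z) (hZ : Z ⟶ T₁Z⟦(1 : ℤ)⟧)
    (hT₀Z : InAdd T T₀Z) (hT₁Z : InAdd T T₁Z)
    (htriZ : Triangle.mk fZ gZ hZ ∈ distTriang C) :
    Nonempty ((T₀Y ⊞ (T₁X ⊞ T₁Z)) ≅ (T₁Y ⊞ (T₀X ⊞ T₀Z))) := by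
  have := cy.shiftFunctor_linear
  have hrX₀ := hT₀X.isSumRetract
  have hrX₁ := hT₁X.isSumRetract
  have hrY₀ := hT₀Y.isSumRetract
  have hrY₁ := hT₁Y.isSumRetract
  have hrZ₀ := hT₀Z.isSumRetract
  have hrZ₁ := hT₁Z.isSumRetract
  obtain ⟨M, a, b, hM, hab⟩ := hf
  refine nonempty_iso_of_finrank_hom_eq hfd hT.1 (hrY₀.biprod (hrX₁.biprod hrZ₁))
    (hrY₁.biprod (hrX₀.biprod hrZ₀)) fun N => ?_
  have hadd := finrankKerPrecomp_add hfd hT.1 htri hM.isSumRetract hab hrX₀ hrX₁ htriX hrY₀ hrY₁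
    htriY hrZ₀ hrZ₁ htriZ
  have h0 := hadd N
  have h1 := hadd (N⟦(1 : ℤ)⟧)
  have h := finrank_hom_triangle hfd htri N
  have hX := finrank_hom_triangle hfd htriX N
  have hY := finrank_hom_triangle hfd htriY N
  have hZ := finrank_hom_triangle hfd htriZ N
  simp only [finrank_hom_biprod hfd]
  lia
end

section
/- Let C be as in the 2-Calabi–Yau setup and T a cluster-tilting object of C, with endomorphism ring End_C(T). For every finite-dimensional right End_C(T)-module M there exists an object X of C such that Hom_C(T, ΣX), viewed as a right End_C(T)-module via precomposition, is isomorphic to M. (Essential surjectivity of the functor H = Hom_C(T, Σ−).) -/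
/-!
STATEMENT 8 (Keller–Reiten / Buan–Marsh–Reiten): In the 2-Calabi–Yau setup, let `T`
be a cluster-tilting object.  Every finite-dimensional right `End_C(T)`-module `M`
(encoded as a finite module over `(End T)ᵐᵒᵖ`) is isomorphic, as a right
`End_C(T)`-module, to `Hom_C(T, ΣX)` for some object `X`, where `End_C(T)` acts by
precomposition.  (Essential surjectivity of `H = Hom_C(T, Σ−)`.)

Krull–Schmidt is encoded as idempotent completeness, which, together with
Hom-finiteness over the field `k`, is equivalent to the Krull–Schmidt property.
-/
open CategoryTheory Limits Pretriangulated

universe v u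

section Presentation

variable {C : Type u} [Category.{v} C] [Preadditive C]

/-- Postcomposition with `g : Y ⟶ Z`, as a map of right `End T`-modules. -/
def postcompLinearMap (T : C) {Y Z : C} (g : Y ⟶ Z) :
    (T ⟶ Y) →ₗ[(End T)ᵐᵒᵖ] (T ⟶ Z) where
  toFun f := f ≫ g
  map_add' _ _ := Preadditive.add_comp _ _ _ _ _ _
  map_smul' _ _ := Category.assoc _ _ _

/-- Postcomposition with an isomorphism, as an isomorphism of right `End T`-modules. -/
def postcompLinearEquiv (T : C) {Y Z : C} (g : Y ≅ Z) :
    (T ⟶ Y) ≃ₗ[(End T)ᵐᵒᵖ] (T ⟶ Z) where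
  __ := postcompLinearMap T g.hom
  invFun f := f ≫ g.inv
  left_inv f := by simp [postcompLinearMap]
  right_inv f := by simp [postcompLinearMap]

theorem isNoetherianRing_end_op (k : Type*) [Field k] [Linear k C] (T : C)
    [FiniteDimensional k (T ⟶ T)] : IsNoetherianRing (End T)ᵐᵒᵖ :=
  have : Module.Finite k (End T) := ‹FiniteDimensional k (T ⟶ T)›
  IsNoetherianRing.of_finite k (End T)ᵐᵒᵖ

variable [HasFiniteBiproducts C]

theorem comp_biproduct_eq_sum {T : C} {n : ℕ} (f : T ⟶ ⨁ (fun _ : Fin n => T)) :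
    f = ∑ i, MulOpposite.op (End.of (f ≫ biproduct.π (fun _ : Fin n => T) i)) •
      biproduct.ι (fun _ : Fin n => T) i := by
  calc f = f ≫ ∑ i, biproduct.π (fun _ : Fin n => T) i ≫ biproduct.ι (fun _ : Fin n => T) i := by
        rw [biproduct.total, Category.comp_id]
    _ = _ := by
        rw [Preadditive.comp_sum]
        exact Finset.sum_congr rfl fun i _ => (Category.assoc _ _ _).symm

instance finite_hom_biproduct (T : C) (n : ℕ) :
    Module.Finite (End T)ᵐᵒᵖ (T ⟶ ⨁ (fun _ : Fin n => T)) := by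
  refine ⟨Submodule.fg_def.mpr ⟨Set.range (biproduct.ι (fun _ : Fin n => T)),
    Set.finite_range _, eq_top_iff.mpr fun f _ => ?_⟩⟩
  rw [comp_biproduct_eq_sum f]
  exact Submodule.sum_mem _ fun i _ =>
    Submodule.smul_mem _ _ (Submodule.subset_span ⟨i, rfl⟩)

/-- The map of right `End T`-modules from `Hom(T, Tⁿ)` sending the `i`-th inclusion to `s i`. -/
noncomputable def homBiproductLift (T : C) {M : Type*} [AddCommGroup M] [Module (End T)ᵐᵒᵖ M] {n : ℕ}
    (s : Fin n → M) : (T ⟶ ⨁ (fun _ : Fin n => T)) →ₗ[(End T)ᵐᵒᵖ] M where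
  toFun f := ∑ i, MulOpposite.op (End.of (f ≫ biproduct.π (fun _ : Fin n => T) i)) • s i
  map_add' f g := by
    rw [← Finset.sum_add_distrib]
    refine Finset.sum_congr rfl fun i _ => ?_
    rw [← add_smul, Preadditive.add_comp]
    rfl
  map_smul' a f := by
    rw [Finset.smul_sum]
    refine Finset.sum_congr rfl fun i _ => ?_
    rw [smul_smul]
    exact congrArg (fun b : End T => MulOpposite.op b • s i) (Category.assoc _ _ _)

theorem homBiproductLift_ι {T : C} {M : Type*} [AddCommGroup M] [Module (End T)ᵐᵒᵖ M] {n : ℕ}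
    (s : Fin n → M) (i : Fin n) :
    homBiproductLift T s (biproduct.ι (fun _ : Fin n => T) i) = s i := by
  refine (Finset.sum_eq_single i (fun j _ hj => ?_)
    (fun h => absurd (Finset.mem_univ i) h)).trans ?_
  · rw [biproduct.ι_π_ne _ hj.symm]
    exact zero_smul _ _
  · rw [biproduct.ι_π_self]
    exact one_smul _ _

theorem homBiproductLift_surjective {T : C} {M : Type*} [AddCommGroup M]
    [Module (End T)ᵐᵒᵖ M] {n : ℕ} (s : Fin n → M)
    (hs : Submodule.span (End T)ᵐᵒᵖ (Set.range s) = ⊤) :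
    Function.Surjective (homBiproductLift T s) := by
  rw [← LinearMap.range_eq_top, eq_top_iff, ← hs, Submodule.span_le]
  rintro _ ⟨i, rfl⟩
  exact ⟨_, homBiproductLift_ι s i⟩

theorem range_postcompLinearMap_desc {T Y : C} {n : ℕ} (d : Fin n → (T ⟶ Y)) :
    LinearMap.range (postcompLinearMap T (biproduct.desc d)) =
      Submodule.span (End T)ᵐᵒᵖ (Set.range d) := by
  apply le_antisymm
  · rintro _ ⟨f, rfl⟩
    rw [comp_biproduct_eq_sum f, map_sum]
    refine Submodule.sum_mem _ fun i _ => ?_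
    rw [map_smul]
    exact Submodule.smul_mem _ _ (Submodule.subset_span ⟨i, (biproduct.ι_desc d i).symm⟩)
  · rw [Submodule.span_le]
    rintro _ ⟨i, rfl⟩
    exact ⟨_, biproduct.ι_desc d i⟩

variable [HasShift C ℤ] [∀ n : ℤ, (shiftFunctor C n).Additive]

theorem eq_zero_of_rigid_biproduct {T : C} (hT : ∀ f : T ⟶ T⟦(1 : ℤ)⟧, f = 0) {n : ℕ}
    (f : T ⟶ (⨁ (fun _ : Fin n => T))⟦(1 : ℤ)⟧) : f = 0 := by
  rw [← Category.comp_id f, ← CategoryTheory.Functor.map_id, ← biproduct.total, Functor.map_sum,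
    Preadditive.comp_sum]
  refine Finset.sum_eq_zero fun i _ => ?_
  rw [Functor.map_comp, ← Category.assoc, hT (f ≫ _), zero_comp]

end Presentation

theorem H_essentially_surjective
    (k : Type*) [Field k]
    (C : Type u) [Category.{v} C] [Preadditive C] [Linear k C] [HasZeroObject C]
    [HasShift C ℤ] [∀ n : ℤ, (shiftFunctor C n).Additive] [Pretriangulated C]
    [HasFiniteBiproducts C] [IsIdempotentComplete C]
    (hfd : ∀ X Y : C, FiniteDimensional k (X ⟶ Y))
    (cy : TwoCYStructure k C)
    (T : C) (hT : IsClusterTilting T)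
    (M : Type v) [AddCommGroup M] [Module (End T)ᵐᵒᵖ M]
    [Module.Finite (End T)ᵐᵒᵖ M] :
    ∃ (X : C) (e : M ≃+ (T ⟶ X⟦(1 : ℤ)⟧)),
      ∀ (f : End T) (m : M), e (MulOpposite.op f • m) = f ≫ e m := by
  have := hfd T T
  have := isNoetherianRing_end_op k T
  obtain ⟨n, s, hs⟩ := Module.Finite.exists_fin (R := (End T)ᵐᵒᵖ) (M := M)
  obtain ⟨p, d, hd⟩ := Submodule.fg_iff_exists_fin_generating_family.mp
    (IsNoetherian.noetherian (LinearMap.ker (homBiproductLift T s)))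
  obtain ⟨Z, g, h, hZ⟩ := distinguished_cocone_triangle (biproduct.desc d)
  have hker : LinearMap.ker (homBiproductLift T s) = LinearMap.ker (postcompLinearMap T g) := by
    rw [← hd, ← range_postcompLinearMap_desc]
    ext f
    constructor
    · rintro ⟨a, rfl⟩
      have hdg : biproduct.desc d ≫ g = 0 := comp_distTriang_mor_zero₁₂ _ hZ
      change (a ≫ biproduct.desc d) ≫ g = 0
      rw [Category.assoc, hdg, comp_zero]
    · intro hf
      obtain ⟨a, ha⟩ := Triangle.coyoneda_exact₂ _ hZ f hf
      exact ⟨a, ha.symm⟩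
  have hsurj : Function.Surjective (postcompLinearMap T g) := fun f => by
    obtain ⟨a, ha⟩ := Triangle.coyoneda_exact₃ _ hZ f (eq_zero_of_rigid_biproduct hT.1 _)
    exact ⟨a, ha.symm⟩
  let e : M ≃ₗ[(End T)ᵐᵒᵖ] (T ⟶ (Z⟦(-1 : ℤ)⟧)⟦(1 : ℤ)⟧) :=
    ((homBiproductLift T s).quotKerEquivOfSurjective (homBiproductLift_surjective s hs)).symm ≪≫ₗ
      Submodule.quotEquivOfEq _ _ hker ≪≫ₗ
      (postcompLinearMap T g).quotKerEquivOfSurjective hsurj ≪≫ₗ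
      postcompLinearEquiv T (shiftNegShift Z (1 : ℤ)).symm
  exact ⟨Z⟦(-1 : ℤ)⟧, e.toAddEquiv, fun f m => e.map_smul (MulOpposite.op f) m⟩
end

section
/- Let C be as in the 2-Calabi–Yau setup and T a cluster-tilting object of C. A morphism f: X → Y in C satisfies (Σf) ∘ g = 0 for every g: T → ΣX if and only if f factors through an object of add T. (The kernel ideal of the functor H = Hom_C(T, Σ−) is the ideal (T) of morphisms factoring through add T.) -/
/-!
STATEMENT 10 (Keller–Reiten / Buan–Marsh–Reiten): In the 2-Calabi–Yau setup, let `T`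
be a cluster-tilting object.  A morphism `f : X ⟶ Y` satisfies `(Σf) ∘ g = 0` for
every `g : T ⟶ ΣX` if and only if `f` factors through an object of `add T`.
(The kernel ideal of `H = Hom_C(T, Σ−)` is the ideal `(T)`.)

Krull–Schmidt is encoded as idempotent completeness, which, together with
Hom-finiteness over the field `k`, is equivalent to the Krull–Schmidt property.
-/
open CategoryTheory Limits Pretriangulated

universe v u

/-- The vanishing of `Hom(X, ΣY)` is symmetric in a 2-Calabi–Yau category. -/
lemma TwoCYStructure.hom_shift_eq_zero {k : Type*} [Field k] {C : Type u} [Category.{v} C]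
    [Preadditive C] [Linear k C] [HasShift C ℤ] (cy : TwoCYStructure k C) {X Y : C}
    (h : ∀ f : X ⟶ Y⟦(1 : ℤ)⟧, f = 0) (g : Y ⟶ X⟦(1 : ℤ)⟧) : g = 0 := by
  refine (cy.bijective Y X).1 (LinearMap.ext fun β => ?_)
  simp [h β]

/-- If `Σf` kills `Hom(T, ΣX)`, then precomposition with `f` kills `Hom(Y, ΣT)`. -/
lemma TwoCYStructure.comp_eq_zero {k : Type*} [Field k] {C : Type u} [Category.{v} C]
    [Preadditive C] [Linear k C] [HasShift C ℤ] (cy : TwoCYStructure k C) {T X Y : C} {f : X ⟶ Y}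
    (hf : ∀ g : T ⟶ X⟦(1 : ℤ)⟧, g ≫ f⟦(1 : ℤ)⟧' = 0) (h : Y ⟶ T⟦(1 : ℤ)⟧) : f ≫ h = 0 := by
  refine (cy.bijective X T).1 (LinearMap.ext fun β => ?_)
  simp [cy.nat_left, hf β]

section

variable {C : Type u} [Category.{v} C] [Preadditive C] [HasZeroObject C]
  [HasShift C ℤ] [∀ n : ℤ, (shiftFunctor C n).Additive] [Pretriangulated C]
  [HasFiniteBiproducts C]

/-- For `T` rigid, `Hom(M, ΣT)` vanishes on `add T`. -/
lemma IsRigid.hom_eq_zero_of_inAdd {T M : C} (hT : IsRigid T) (hM : InAdd T M)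
    (h : M ⟶ T⟦(1 : ℤ)⟧) : h = 0 := by
  obtain ⟨n, N, ⟨e⟩⟩ := hM
  have h0 : e.inv ≫ biprod.fst ≫ h = 0 :=
    biproduct.hom_ext' _ _ fun i => by rw [hT (_ ≫ e.inv ≫ _), comp_zero]
  have h1 : h = biprod.inl ≫ e.hom ≫ e.inv ≫ biprod.fst ≫ h := by simp
  rw [h1, h0, comp_zero, comp_zero]

/-- For `T` rigid, every object `Y` is the target of a morphism `p` from an object `M` with
`Hom(M, ΣT) = 0`, such that every morphism to `Y` killed by `Hom(Y, ΣT)` factors through `p`. -/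
lemma IsRigid.exists_hom_shift_eq_zero_and_factors (k : Type*) [Field k] [Linear k C] {T : C}
    (hT : IsRigid T) (Y : C) [FiniteDimensional k (Y ⟶ T⟦(1 : ℤ)⟧)] :
    ∃ (M : C) (p : M ⟶ Y), (∀ m : M ⟶ T⟦(1 : ℤ)⟧, m = 0) ∧
      ∀ {X : C} (f : X ⟶ Y), (∀ h : Y ⟶ T⟦(1 : ℤ)⟧, f ≫ h = 0) → ∃ a : X ⟶ M, f = a ≫ p := by
  let B := Module.finBasis k (Y ⟶ T⟦(1 : ℤ)⟧)
  let φ : Y ⟶ ⨁ fun _ : Fin (Module.finrank k (Y ⟶ T⟦(1 : ℤ)⟧)) => T⟦(1 : ℤ)⟧ :=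
    biproduct.lift fun i => B i
  obtain ⟨M, p, δ, hδ⟩ := distinguished_cocone_triangle₁ φ
  have hpφ : p ≫ φ = 0 := comp_distTriang_mor_zero₁₂ _ hδ
  refine ⟨M, p, fun m => ?_, fun f hf => ?_⟩
  · have hm : δ ≫ m⟦(1 : ℤ)⟧' = 0 := by
      refine biproduct.hom_ext' _ _ fun i => ?_
      obtain ⟨t, ht⟩ := (shiftFunctor C (1 : ℤ)).map_surjective
        (biproduct.ι (fun _ => T⟦(1 : ℤ)⟧) i ≫ δ ≫ m⟦(1 : ℤ)⟧')
      rw [← ht, hT t, Functor.map_zero, comp_zero]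
    obtain ⟨y', hy'⟩ := Triangle.yoneda_exact₃ _ (rot_of_distTriang _ hδ) (m⟦(1 : ℤ)⟧') hm
    obtain ⟨y : Y ⟶ T⟦(1 : ℤ)⟧, rfl⟩ := (shiftFunctor C (1 : ℤ)).map_surjective y'
    have hy : m = -(p ≫ y) := (shiftFunctor C (1 : ℤ)).map_injective <| by
      rw [Functor.map_neg, Functor.map_comp, ← Preadditive.neg_comp]
      exact hy'
    have hb : ∀ i, p ≫ B i = 0 := fun i => by
      simpa [φ] using hpφ =≫ biproduct.π (fun _ => T⟦(1 : ℤ)⟧) i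
    rw [hy, ← B.sum_repr y, Preadditive.comp_sum]
    simp [hb]
  · have hfφ : f ≫ φ = 0 := biproduct.hom_ext _ _ fun i => by simp [φ, hf]
    exact Triangle.coyoneda_exact₂ _ hδ f hfφ

end

theorem H_kernel_ideal
    (k : Type*) [Field k]
    (C : Type u) [Category.{v} C] [Preadditive C] [Linear k C] [HasZeroObject C]
    [HasShift C ℤ] [∀ n : ℤ, (shiftFunctor C n).Additive] [Pretriangulated C]
    [HasFiniteBiproducts C] [IsIdempotentComplete C]
    (hfd : ∀ X Y : C, FiniteDimensional k (X ⟶ Y))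
    (cy : TwoCYStructure k C)
    (T : C) (hT : IsClusterTilting T)
    (X Y : C) (f : X ⟶ Y) :
    (∀ g : T ⟶ X⟦(1 : ℤ)⟧, g ≫ f⟦(1 : ℤ)⟧' = 0) ↔
      ∃ (M : C) (a : X ⟶ M) (b : M ⟶ Y), InAdd T M ∧ f = a ≫ b := by
  constructor
  · intro hf
    have := hfd Y (T⟦(1 : ℤ)⟧)
    obtain ⟨M, p, hM, hp⟩ := hT.1.exists_hom_shift_eq_zero_and_factors k Y
    obtain ⟨a, ha⟩ := hp f (cy.comp_eq_zero hf)
    exact ⟨M, a, p, hT.2 M (cy.hom_shift_eq_zero hM), ha⟩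
  · rintro ⟨M, a, b, hM, rfl⟩ g
    rw [Functor.map_comp, ← Category.assoc,
      cy.hom_shift_eq_zero (hT.1.hom_eq_zero_of_inAdd hM) (g ≫ a⟦(1 : ℤ)⟧'), zero_comp]
end
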